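/- There exists a universal constant C > 0 with the following property. For every dimension d ∈ ℕ, every M, n ∈ ℕ and every m ∈ ℕ with m ≥ ⌈C·n·d·log*(n)²·log*(M)⌉, there exist sampling points x¹,…,x^m ∈ 𝕋^d and a reconstruction map R : ℂ^m → C(𝕋^d) such that for every continuous function f on 𝕋^d and every q with 2 ≤ q ≤ ∞ it holds ‖f − R(f(x¹),…,f(x^m))‖_{L_q(𝕋^d)} ≤ C·n^{1/2−1/q}·( n^{−1/2}·σ_n(f)_A + E_{[−M,M]^d}(f)_{L∞} ). -/

import Mathlib

open MeasureTheory Real ENNReal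

noncomputable section

namespace Paper

/-- The fundamental domain `[0,1)^d` of the `d`-dimensional torus `𝕋^d`. -/
def cube (d : ℕ) : Set (Fin d → ℝ) := Set.univ.pi fun _ => Set.Ico (0:ℝ) 1

/-- The trigonometric character `x ↦ e^{2π i k·x}`. -/
def expk (d : ℕ) (k : Fin d → ℤ) (x : Fin d → ℝ) : ℂ :=
  Complex.exp (((2 * Real.pi * ∑ i, (k i : ℝ) * x i : ℝ) : ℂ) * Complex.I)

/-- Fourier coefficient `f̂(k) = ∫_{[0,1)^d} f(x) e^{-2π i k·x} dx`. -/
def fCoeff (d : ℕ) (f : (Fin d → ℝ) → ℂ) (k : Fin d → ℤ) : ℂ :=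
  ∫ x in cube d, f x * expk d (-k) x

/-- The `L_q` (quasi-)norm on the torus, `q ∈ (0,∞]`, valued in `ℝ≥0∞`
(for `q = ∞` this is the essential supremum). -/
def LqNorm (d : ℕ) (q : ℝ≥0∞) (f : (Fin d → ℝ) → ℂ) : ℝ≥0∞ :=
  eLpNorm f q (volume.restrict (cube d))

/-- The weight `∏_{i=1}^d (1+|k_i|)`. -/
def wt (d : ℕ) (k : Fin d → ℤ) : ℝ := ∏ i, (1 + |(k i : ℝ)|)

/-- The weighted Wiener (quasi-)norm `‖f‖_{S^r_θ A}`
(with the sup modification for `θ = ∞`); `A_θ` corresponds to `r = 0`,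
the Wiener algebra `A` to `r = 0`, `θ = 1`. -/
def wienerNorm (d : ℕ) (r : ℝ) (θ : ℝ≥0∞) (f : (Fin d → ℝ) → ℂ) : ℝ≥0∞ :=
  if θ = ∞ then ⨆ k : Fin d → ℤ, ENNReal.ofReal (wt d k ^ r) * (‖fCoeff d f k‖₊ : ℝ≥0∞)
  else (∑' k : Fin d → ℤ,
      (ENNReal.ofReal (wt d k ^ r) * (‖fCoeff d f k‖₊ : ℝ≥0∞)) ^ θ.toReal) ^ (1 / θ.toReal)

/-- Trigonometric polynomials with at most `m` terms. -/
def trigPoly (d m : ℕ) : Set ((Fin d → ℝ) → ℂ) :=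
  {s | ∃ (Λ : Finset (Fin d → ℤ)) (a : (Fin d → ℤ) → ℂ),
    Λ.card ≤ m ∧ s = fun x => ∑ k ∈ Λ, a k * expk d k x}

/-- Best `m`-term trigonometric approximation error of `f`, error measured by `X`. -/
def sigmaF (d m : ℕ) (X : ((Fin d → ℝ) → ℂ) → ℝ≥0∞) (f : (Fin d → ℝ) → ℂ) : ℝ≥0∞ :=
  ⨅ s ∈ trigPoly d m, X (f - s)

/-- The unit ball of the space (inside `L₁(𝕋^d)`) with (quasi-)norm `N`. -/
def unitBall (d : ℕ) (N : ((Fin d → ℝ) → ℂ) → ℝ≥0∞) : Set ((Fin d → ℝ) → ℂ) :=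
  {f | IntegrableOn f (cube d) ∧ N f ≤ 1}

/-- Best `m`-term trigonometric width of the unit ball of `N`, error measured by `X`. -/
def sigmaClass (d m : ℕ) (N X : ((Fin d → ℝ) → ℂ) → ℝ≥0∞) : ℝ≥0∞ :=
  ⨆ f ∈ unitBall d N, sigmaF d m X f

/-- `log*(m) = max (log₂ m) 1`. -/
def logStar (m : ℕ) : ℝ := max (Real.logb 2 m) 1

/-- Two-sided asymptotic equivalence `a_m ≍ b_m`. -/
def IsAsympEquiv (a : ℕ → ℝ≥0∞) (b : ℕ → ℝ) : Prop :=
  ∃ c C : ℝ, 0 < c ∧ 0 < C ∧ ∃ m₀ : ℕ, ∀ m : ℕ, m₀ ≤ m →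
    ENNReal.ofReal (c * b m) ≤ a m ∧ a m ≤ ENNReal.ofReal (C * b m)

/-- One-sided asymptotic bound `a_m ≲ b_m`. -/
def IsAsympLe (a : ℕ → ℝ≥0∞) (b : ℕ → ℝ) : Prop :=
  ∃ C : ℝ, 0 < C ∧ ∃ m₀ : ℕ, ∀ m : ℕ, m₀ ≤ m → a m ≤ ENNReal.ofReal (C * b m)

/-- Dyadic block `I_0 = {0}`, `I_n = {k : 2^{n-1} ≤ |k| < 2^n}` for `n ≥ 1`. -/
def blockF (n : ℕ) : Finset ℤ :=
  (Finset.Icc (-(2^n : ℤ)) (2^n)).filter fun k =>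
    (n = 0 ∧ k = 0) ∨ (n ≠ 0 ∧ 2^(n-1) ≤ |k| ∧ |k| < 2^n)

/-- The dyadic block projection `∑_{k ∈ I_j} f̂(k) e^{2π i k·x}`. -/
def blockProj (d : ℕ) (f : (Fin d → ℝ) → ℂ) (j : Fin d → ℕ) : (Fin d → ℝ) → ℂ :=
  fun x => ∑ k ∈ Fintype.piFinset (fun i => blockF (j i)), fCoeff d f k * expk d k x

/-- The mixed-smoothness Besov (quasi-)norm `‖f‖_{S^s_{p,θ}B}`
(with the sup modification for `θ = ∞`). -/
def besovNorm (d : ℕ) (s : ℝ) (p θ : ℝ≥0∞) (f : (Fin d → ℝ) → ℂ) : ℝ≥0∞ :=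
  if θ = ∞ then
    ⨆ j : Fin d → ℕ,
      ENNReal.ofReal ((2:ℝ) ^ (((∑ i, j i : ℕ) : ℝ) * s)) * LqNorm d p (blockProj d f j)
  else
    (∑' j : Fin d → ℕ,
      (ENNReal.ofReal ((2:ℝ) ^ (((∑ i, j i : ℕ) : ℝ) * s)) * LqNorm d p (blockProj d f j))
        ^ θ.toReal) ^ (1 / θ.toReal)

/-- The mixed-smoothness Sobolev norm `‖f‖_{S^s_p W}` (Littlewood–Paley form),
with `S^0_p W := L_p`. -/
def sobolevNorm (d : ℕ) (s : ℝ) (p : ℝ≥0∞) (f : (Fin d → ℝ) → ℂ) : ℝ≥0∞ :=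
  if s = 0 then LqNorm d p f
  else
    (∫⁻ x in cube d,
      ((∑' j : Fin d → ℕ,
        (ENNReal.ofReal ((2:ℝ) ^ (((∑ i, j i : ℕ) : ℝ) * s)) *
          (‖blockProj d f j x‖₊ : ℝ≥0∞)) ^ (2:ℕ)) ^ ((1:ℝ)/2)) ^ p.toReal) ^ (1 / p.toReal)

/-- Trigonometric polynomials with frequencies in `[-M,M]^d`. -/
def boxPoly (d M : ℕ) : Set ((Fin d → ℝ) → ℂ) :=
  {s | ∃ (Λ : Finset (Fin d → ℤ)) (a : (Fin d → ℤ) → ℂ),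
    (∀ k ∈ Λ, ∀ i, |k i| ≤ (M : ℤ)) ∧ s = fun x => ∑ k ∈ Λ, a k * expk d k x}

/-- Error of best approximation by trigonometric polynomials with
frequencies in `[-M,M]^d`, measured in `L_∞`. -/
def EBox (d M : ℕ) (f : (Fin d → ℝ) → ℂ) : ℝ≥0∞ :=
  ⨅ g ∈ boxPoly d M, LqNorm d ∞ (f - g)

/-- The `m`-th (non-linear) sampling width of the class of continuous functions
in the unit ball of `N`, error measured in `L_q`. -/
def samplingWidth (d m : ℕ) (N : ((Fin d → ℝ) → ℂ) → ℝ≥0∞) (q : ℝ≥0∞) : ℝ≥0∞ :=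
  ⨅ (t : Fin m → (Fin d → ℝ)) (_ : ∀ i, t i ∈ cube d)
    (R : (Fin m → ℂ) → ((Fin d → ℝ) → ℂ)),
    ⨆ f ∈ {f : (Fin d → ℝ) → ℂ | Continuous f ∧ N f ≤ 1},
      LqNorm d q (f - R fun i => f (t i))

/-- Derandomised sampling: some choice of `m` points does at least as well as the average. -/
lemma exists_points {X κ : Type*} [MeasurableSpace X] (μ : Measure X) [IsProbabilityMeasure μ]
    (s : Finset κ) (A : κ → Set X) (hA : ∀ k, MeasurableSet (A k)) (p : κ → ℝ)
    (hp : ∀ k ∈ s, p k ≤ μ.real (A k)) (D : Set X) (hD : μ Dᶜ = 0) (m : ℕ) (W : κ → ℝ)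
    (hW : ∀ k, 0 ≤ W k) :
    ∃ x : Fin m → X, (∀ i, x i ∈ D) ∧
      ∑ k ∈ s, W k * ∏ i, (1 - (A k).indicator (fun _ => (1 / 2 : ℝ)) (x i)) ≤
        ∑ k ∈ s, W k * (1 - p k / 2) ^ m := by
  induction m generalizing W with
  | zero => exact ⟨Fin.elim0, fun i => i.elim0, by simp⟩
  | succ m ih =>
    have hintg : ∀ k, Integrable (fun x => 1 - (A k).indicator (fun _ => (1 / 2 : ℝ)) x) μ :=
      fun k => (integrable_const _).sub ((integrable_const _).indicator (hA k))
    have hval : ∀ k, ∫ x, (1 - (A k).indicator (fun _ => (1 / 2 : ℝ)) x) ∂μ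
        = 1 - μ.real (A k) / 2 := by
      intro k
      rw [integral_sub (integrable_const _) ((integrable_const _).indicator (hA k)),
        integral_indicator_const _ (hA k)]
      simp
      ring
    have hp1 : ∀ k ∈ s, 0 ≤ 1 - p k / 2 := by
      intro k hk
      have := hp k hk
      have := measureReal_le_one (μ := μ) (s := A k)
      linarith
    obtain ⟨x₀, hx₀D, hx₀⟩ := exists_notMem_null_le_integral (μ := μ)
      (f := fun x => ∑ k ∈ s, (W k * (1 - p k / 2) ^ m) *
        (1 - (A k).indicator (fun _ => (1 / 2 : ℝ)) x))
      (integrable_finsetSum _ fun k _ => (hintg k).const_mul _) hD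
    have hind : ∀ k, 0 ≤ 1 - (A k).indicator (fun _ => (1 / 2 : ℝ)) x₀ := by
      intro k
      by_cases h : x₀ ∈ A k
      · simp only [h, Set.indicator_of_mem]
        norm_num
      · simp [h]
    obtain ⟨x, hxD, hx⟩ := ih (fun k => W k * (1 - (A k).indicator (fun _ => (1 / 2 : ℝ)) x₀))
      (fun k => mul_nonneg (hW k) (hind k))
    refine ⟨Fin.cons x₀ x, ?_, ?_⟩
    · intro i
      refine Fin.cases ?_ (fun i => ?_) i
      · simpa using hx₀D
      · simpa using hxD i
    · calc _ = ∑ k ∈ s, W k * (1 - (A k).indicator (fun _ => (1 / 2 : ℝ)) x₀) *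
            ∏ i, (1 - (A k).indicator (fun _ => (1 / 2 : ℝ)) (x i)) := by
              simp [Fin.prod_univ_succ, mul_assoc]
        _ ≤ _ := hx
        _ = ∑ k ∈ s, (W k * (1 - p k / 2) ^ m) *
            (1 - (A k).indicator (fun _ => (1 / 2 : ℝ)) x₀) :=
              Finset.sum_congr rfl fun k _ => by ring
        _ ≤ _ := hx₀
        _ = ∑ k ∈ s, (W k * (1 - p k / 2) ^ m) * (1 - μ.real (A k) / 2) := by
              rw [integral_finsetSum _ fun k _ => (hintg k).const_mul _]
              simp only [integral_const_mul, hval]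
        _ ≤ _ := by
              refine Finset.sum_le_sum fun k hk => ?_
              rw [pow_succ, ← mul_assoc]
              refine mul_le_mul_of_nonneg_left ?_ (mul_nonneg (hW k) (pow_nonneg (hp1 k hk) _))
              linarith [hp k hk]

lemma exp_le_one_add_add_sq {y : ℝ} (hy : |y| ≤ 1) : Real.exp y ≤ 1 + y + y ^ 2 := by
  have := Real.abs_exp_sub_one_sub_id_le hy
  linarith [(abs_le.1 this).2]

/-- Chernoff bound for the sum of `L` independent draws of a centred bounded variable. -/
lemma sum_tail_le {ι : Type*} [Fintype ι] (q y : ι → ℝ) (hq : ∀ i, 0 ≤ q i)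
    (hq1 : ∑ i, q i = 1) (hy : ∀ i, |y i| ≤ 2) (hmean : ∑ i, q i * y i = 0) (L : ℕ) (s : ℝ)
    (hs : 0 ≤ s) (hs1 : s ≤ 1) :
    ∑ τ : Fin L → ι, (∏ l, q (τ l)) * (if s * L / 2 ≤ ∑ l, y (τ l) then 1 else 0) ≤
      Real.exp (-(L * s ^ 2 / 64)) := by
  have hone : ∑ i, q i * Real.exp (s / 16 * y i) ≤ Real.exp (s ^ 2 / 64) := by
    calc _ ≤ ∑ i, q i * (1 + s / 16 * y i + s ^ 2 / 64) := by
          refine Finset.sum_le_sum fun i _ => mul_le_mul_of_nonneg_left ?_ (hq i)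
          have h2 := hy i
          have : |s / 16 * y i| ≤ 1 := by
            rw [abs_mul, abs_of_nonneg (by positivity)]
            nlinarith [abs_nonneg (y i)]
          refine (exp_le_one_add_add_sq this).trans ?_
          have : y i ^ 2 ≤ 4 := by
            rw [← sq_abs]; nlinarith [abs_nonneg (y i)]
          nlinarith [mul_le_mul_of_nonneg_left this (sq_nonneg s)]
      _ = (∑ i, q i) * (1 + s ^ 2 / 64) + s / 16 * ∑ i, q i * y i := by
          rw [Finset.sum_mul, Finset.mul_sum, ← Finset.sum_add_distrib]
          exact Finset.sum_congr rfl fun i _ => by ring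
      _ ≤ _ := by
          rw [hq1, hmean]
          have := Real.add_one_le_exp (s ^ 2 / 64)
          linarith
  calc _ ≤ ∑ τ : Fin L → ι, (∏ l, q (τ l)) *
        (Real.exp (s / 16 * ∑ l, y (τ l)) * Real.exp (-(s ^ 2 / 32 * L))) := by
        refine Finset.sum_le_sum fun τ _ => mul_le_mul_of_nonneg_left ?_
          (Finset.prod_nonneg fun l _ => hq _)
        split_ifs with h
        · rw [← Real.exp_add]
          refine Real.one_le_exp ?_
          nlinarith
        · positivity
    _ = (∑ i, q i * Real.exp (s / 16 * y i)) ^ L * Real.exp (-(s ^ 2 / 32 * L)) := by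
        rw [Fintype.sum_pow, Finset.sum_mul]
        refine Finset.sum_congr rfl fun τ _ => ?_
        rw [Finset.mul_sum, Real.exp_sum, Finset.prod_mul_distrib]
        ring
    _ ≤ Real.exp (s ^ 2 / 64) ^ L * Real.exp (-(s ^ 2 / 32 * L)) := by
        refine mul_le_mul_of_nonneg_right (pow_le_pow_left₀ ?_ hone _) (Real.exp_pos _).le
        exact Finset.sum_nonneg fun i _ => mul_nonneg (hq i) (Real.exp_pos _).le
    _ = _ := by
        rw [← Real.exp_nat_mul, ← Real.exp_add]
        congr 1
        ring

lemma sum_tail_le_complex {ι : Type*} [Fintype ι] (q : ι → ℝ) (z : ι → ℂ) (hq : ∀ i, 0 ≤ q i)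
    (hq1 : ∑ i, q i = 1) (hz : ∀ i, ‖z i‖ ≤ 2) (hmean : ∑ i, (q i : ℂ) * z i = 0) (L : ℕ) (s : ℝ)
    (hs : 0 ≤ s) (hs1 : s ≤ 1) :
    ∑ τ : Fin L → ι, (∏ l, q (τ l)) * (if s * L ≤ ‖∑ l, z (τ l)‖ then 1 else 0) ≤
      4 * Real.exp (-(L * s ^ 2 / 64)) := by
  have hre : ∑ i, q i * (z i).re = 0 := by simpa using congrArg Complex.re hmean
  have him : ∑ i, q i * (z i).im = 0 := by simpa using congrArg Complex.im hmean
  have h1 := sum_tail_le q (fun i => (z i).re) hq hq1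
    (fun i => (Complex.abs_re_le_norm _).trans (hz i)) hre L s hs hs1
  have h2 := sum_tail_le q (fun i => -(z i).re) hq hq1
    (fun i => by rw [abs_neg]; exact (Complex.abs_re_le_norm _).trans (hz i))
    (by simp [hre]) L s hs hs1
  have h3 := sum_tail_le q (fun i => (z i).im) hq hq1
    (fun i => (Complex.abs_im_le_norm _).trans (hz i)) him L s hs hs1
  have h4 := sum_tail_le q (fun i => -(z i).im) hq hq1
    (fun i => by rw [abs_neg]; exact (Complex.abs_im_le_norm _).trans (hz i))
    (by simp [him]) L s hs hs1
  refine le_trans ?_ ((add_le_add (add_le_add h1 h2) (add_le_add h3 h4)).trans_eq (by ring))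
  simp only [← Finset.sum_add_distrib, ← mul_add]
  refine Finset.sum_le_sum fun τ _ => mul_le_mul_of_nonneg_left ?_
    (Finset.prod_nonneg fun l _ => hq _)
  have hn := Complex.norm_le_abs_re_add_abs_im (∑ l, z (τ l))
  rw [Complex.re_sum, Complex.im_sum] at hn
  simp only [Finset.sum_neg_distrib]
  rcases abs_cases (∑ l, (z (τ l)).re) with h | h <;>
  rcases abs_cases (∑ l, (z (τ l)).im) with h' | h' <;>
  split_ifs <;> linarith

/-- Maurey's empirical method: a convex combination of bounded functions is approximated, up to
small exceptional sets for a measure and for a point sample, by an average of few atoms of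
small total complexity. -/
lemma exists_maurey_tuple {X ι : Type*} [MeasurableSpace X] [Fintype ι] (μ : Measure X)
    [IsProbabilityMeasure μ] (φ : ι → X → ℂ) (hφm : ∀ i, Measurable (φ i))
    (hφ : ∀ i x, ‖φ i x‖ ≤ 1) (q : ι → ℝ) (hq : ∀ i, 0 ≤ q i) (hq1 : ∑ i, q i = 1)
    (ℓ : ι → ℝ) (hℓ : ∀ i, 0 ≤ ℓ i) (H : ℝ) (hH : 0 < H) (hqℓ : ∑ i, q i * ℓ i ≤ H)
    (L : ℕ) (hL : 0 < L) (s : ℝ) (hs : 0 ≤ s) (hs1 : s ≤ 1) (η : ℝ) (hη : 0 < η)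
    (hLη : 4 * Real.exp (-(L * s ^ 2 / 64)) ≤ η) (m : ℕ) (hm : 0 < m) (x : Fin m → X) :
    ∃ τ : Fin L → ι,
      μ.real {a | s * L ≤ ‖∑ l, (φ (τ l) a - ∑ i, (q i : ℂ) * φ i a)‖} ≤ 4 * η ∧
      ∑ j, {a | s * L ≤ ‖∑ l, (φ (τ l) a - ∑ i, (q i : ℂ) * φ i a)‖}.indicator
        (fun _ => (1 : ℝ)) (x j) ≤ 4 * η * m ∧
      ∑ l, ℓ (τ l) ≤ 4 * L * H := by
  classical
  set w : (Fin L → ι) → ℝ := fun τ => ∏ l, q (τ l) with hw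
  set B : (Fin L → ι) → Set X :=
    fun τ => {a | s * L ≤ ‖∑ l, (φ (τ l) a - ∑ i, (q i : ℂ) * φ i a)‖} with hB
  have hw0 : ∀ τ, 0 ≤ w τ := fun τ => Finset.prod_nonneg fun l _ => hq _
  have hw1 : ∑ τ, w τ = 1 := by
    rw [hw, ← Fintype.sum_pow, hq1, one_pow]
  have hBm : ∀ τ, MeasurableSet (B τ) := by
    intro τ
    refine measurableSet_le measurable_const (Measurable.norm ?_)
    fun_prop
  have htail : ∀ a, ∑ τ, w τ * (B τ).indicator (fun _ => (1 : ℝ)) a ≤ η := by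
    intro a
    have hmn : ‖∑ i, (q i : ℂ) * φ i a‖ ≤ 1 := by
      refine (norm_sum_le _ _).trans ?_
      rw [← hq1]
      refine Finset.sum_le_sum fun i _ => ?_
      rw [norm_mul, Complex.norm_real, Real.norm_of_nonneg (hq i)]
      exact mul_le_of_le_one_right (hq i) (hφ i a)
    refine le_trans (le_of_eq ?_) ((sum_tail_le_complex q
      (fun i => φ i a - ∑ i, (q i : ℂ) * φ i a) hq hq1 ?_ ?_ L s hs hs1).trans hLη)
    · refine Finset.sum_congr rfl fun τ _ => ?_
      simp [hw, hB, Set.indicator_apply]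
    · intro i
      refine (norm_sub_le _ _).trans ?_
      linarith [hφ i a]
    · simp only [mul_sub, Finset.sum_sub_distrib, ← Finset.sum_mul]
      rw [← Complex.ofReal_sum, hq1]
      simp
  have hμ : ∑ τ, w τ * μ.real (B τ) ≤ η := by
    have h1 : ∀ τ, Integrable ((B τ).indicator (fun _ => (1 : ℝ))) μ :=
      fun τ => (integrable_const _).indicator (hBm τ)
    calc _ = ∫ a, ∑ τ, w τ * (B τ).indicator (fun _ => (1 : ℝ)) a ∂μ := by
          rw [integral_finsetSum _ fun τ _ => (h1 τ).const_mul _]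
          refine Finset.sum_congr rfl fun τ _ => ?_
          rw [integral_const_mul, integral_indicator_const _ (hBm τ)]
          simp
      _ ≤ ∫ a, η ∂μ := integral_mono (integrable_finsetSum _ fun τ _ => (h1 τ).const_mul _)
          (integrable_const _) htail
      _ = η := by simp
  have hemp : ∑ τ, w τ * ∑ j, (B τ).indicator (fun _ => (1 : ℝ)) (x j) ≤ η * m := by
    simp only [Finset.mul_sum]
    rw [Finset.sum_comm]
    refine (Finset.sum_le_sum fun j _ => htail (x j)).trans ?_
    simp [mul_comm]
  have hcost : ∑ τ, w τ * ∑ l, ℓ (τ l) ≤ L * H := by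
    have hmarg : ∀ l : Fin L, ∑ τ, w τ * ℓ (τ l) = ∑ i, q i * ℓ i := by
      intro l
      have : ∀ τ : Fin L → ι, w τ * ℓ (τ l)
          = ∏ l', (q (τ l') * if l' = l then ℓ (τ l') else 1) := by
        intro τ
        rw [Finset.prod_mul_distrib, Finset.prod_ite_eq']
        simp [hw]
      simp only [this]
      rw [← Fintype.piFinset_univ, ← Finset.prod_univ_sum (fun _ => Finset.univ)
        (fun l' i => q i * if l' = l then ℓ i else 1)]
      rw [Finset.prod_eq_single l]
      · simp
      · intro b _ hb
        simp [hb, hq1]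
      · simp
    simp only [Finset.mul_sum]
    rw [Finset.sum_comm]
    simp only [hmarg]
    simp only [Finset.sum_const, Finset.card_univ, Fintype.card_fin, nsmul_eq_mul]
    gcongr
  have hmR : (0 : ℝ) < m := by exact_mod_cast hm
  have hLR : (0 : ℝ) < L := by exact_mod_cast hL
  by_contra! hcon
  have hbig : ∀ τ, 1 ≤ μ.real (B τ) / (4 * η)
      + (∑ j, (B τ).indicator (fun _ => (1 : ℝ)) (x j)) / (4 * η * m)
      + (∑ l, ℓ (τ l)) / (4 * L * H) := by
    intro τ
    have e1 : 0 ≤ μ.real (B τ) / (4 * η) := by positivity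
    have e2 : 0 ≤ (∑ j, (B τ).indicator (fun _ => (1 : ℝ)) (x j)) / (4 * η * m) :=
      div_nonneg (Finset.sum_nonneg fun j _ => Set.indicator_nonneg (by simp) _) (by positivity)
    have e3 : 0 ≤ (∑ l, ℓ (τ l)) / (4 * L * H) :=
      div_nonneg (Finset.sum_nonneg fun l _ => hℓ _) (by positivity)
    by_cases c1 : μ.real (B τ) ≤ 4 * η
    · by_cases c2 : ∑ j, (B τ).indicator (fun _ => (1 : ℝ)) (x j) ≤ 4 * η * m
      · have := (one_le_div (by positivity)).2 (hcon τ c1 c2).le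
        linarith
      · have := (one_le_div (by positivity)).2 (not_le.1 c2).le
        linarith
    · have := (one_le_div (by positivity)).2 (not_le.1 c1).le
      linarith
  have hsum : (1 : ℝ) ≤ 3 / 4 := by
    calc (1 : ℝ) = ∑ τ, w τ * 1 := by simp [hw1]
      _ ≤ ∑ τ, w τ * (μ.real (B τ) / (4 * η)
          + (∑ j, (B τ).indicator (fun _ => (1 : ℝ)) (x j)) / (4 * η * m)
          + (∑ l, ℓ (τ l)) / (4 * L * H)) :=
          Finset.sum_le_sum fun τ _ => mul_le_mul_of_nonneg_left (hbig τ) (hw0 τ)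
      _ = (∑ τ, w τ * μ.real (B τ)) / (4 * η)
          + (∑ τ, w τ * ∑ j, (B τ).indicator (fun _ => (1 : ℝ)) (x j)) / (4 * η * m)
          + (∑ τ, w τ * ∑ l, ℓ (τ l)) / (4 * L * H) := by
          rw [Finset.sum_div, Finset.sum_div, Finset.sum_div, ← Finset.sum_add_distrib,
            ← Finset.sum_add_distrib]
          exact Finset.sum_congr rfl fun τ _ => by ring
      _ ≤ η / (4 * η) + η * m / (4 * η * m) + L * H / (4 * L * H) := by gcongr
      _ = 3 / 4 := by field_simp; norm_num
  norm_num at hsum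

lemma sq_le_dyadic_sum (u : ℝ) (hu : 0 ≤ u) (Q : ℕ) (hQ : u ≤ 2 ^ Q / 2) :
    u ^ 2 ≤ 1 / 4 + ∑ j ∈ Finset.range Q, (4 : ℝ) ^ j * if (2 : ℝ) ^ j / 2 ≤ u then 1 else 0 := by
  induction Q with
  | zero => simp at hQ ⊢; nlinarith
  | succ Q ih =>
    rw [Finset.sum_range_succ]
    by_cases h : u ≤ 2 ^ Q / 2
    · have := ih h
      have h4 : (0 : ℝ) ≤ 4 ^ Q * if (2 : ℝ) ^ Q / 2 ≤ u then 1 else 0 := by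
        split_ifs <;> positivity
      linarith
    · have h0 : (0 : ℝ) ≤
          ∑ j ∈ Finset.range Q, (4 : ℝ) ^ j * if (2 : ℝ) ^ j / 2 ≤ u then 1 else 0 :=
        Finset.sum_nonneg fun j _ => by split_ifs <;> positivity
      rw [if_pos (not_le.1 h).le]
      have h2 : u ≤ 2 ^ Q := by rw [pow_succ] at hQ; linarith
      have h3 : (4 : ℝ) ^ Q = (2 ^ Q) ^ 2 := by rw [← pow_mul, mul_comm, pow_mul]; norm_num
      rw [h3]
      nlinarith

/-- A bounded function of unit `L₂` norm has a dyadic level carrying a fair share of its norm. -/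
lemma exists_dyadic_level {X : Type*} [MeasurableSpace X] (μ : Measure X) [IsProbabilityMeasure μ]
    (G : X → ℂ) (hG : Measurable G) (Q : ℕ) (hGQ : ∀ x, ‖G x‖ ≤ 2 ^ Q / 2)
    (hG2 : ∫ x, ‖G x‖ ^ 2 ∂μ = 1) :
    ∃ j < Q, 3 / (4 * 4 ^ j * Q) ≤ μ.real {x | (2 : ℝ) ^ j / 2 ≤ ‖G x‖} := by
  have hm : ∀ j : ℕ, MeasurableSet {x | (2 : ℝ) ^ j / 2 ≤ ‖G x‖} :=
    fun j => measurableSet_le measurable_const hG.norm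
  have hi : ∀ j : ℕ, Integrable ({x | (2 : ℝ) ^ j / 2 ≤ ‖G x‖}.indicator (fun _ => (1 : ℝ))) μ :=
    fun j => (integrable_const _).indicator (hm j)
  have key : 1 ≤ 1 / 4 + ∑ j ∈ Finset.range Q,
      (4 : ℝ) ^ j * μ.real {x | (2 : ℝ) ^ j / 2 ≤ ‖G x‖} := by
    calc (1 : ℝ) = ∫ x, ‖G x‖ ^ 2 ∂μ := hG2.symm
      _ ≤ ∫ x, (1 / 4 + ∑ j ∈ Finset.range Q, (4 : ℝ) ^ j *
          {x | (2 : ℝ) ^ j / 2 ≤ ‖G x‖}.indicator (fun _ => (1 : ℝ)) x) ∂μ := by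
          refine integral_mono_of_nonneg (Filter.Eventually.of_forall fun x => by positivity)
            ((integrable_const _).add (integrable_finsetSum _ fun j _ => (hi j).const_mul _))
            (Filter.Eventually.of_forall fun x => ?_)
          simpa [Set.indicator_apply] using sq_le_dyadic_sum ‖G x‖ (norm_nonneg _) Q (hGQ x)
      _ = _ := by
          rw [integral_add (integrable_const _)
            (integrable_finsetSum _ fun j _ => (hi j).const_mul _),
            integral_finsetSum _ fun j _ => (hi j).const_mul _]
          simp only [integral_const_mul, integral_indicator_const _ (hm _)]
          simp
  by_contra! hcon
  rcases Nat.eq_zero_or_pos Q with h0 | h0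
  · subst h0
    norm_num at key
  have hQ : (0 : ℝ) < Q := by exact_mod_cast h0
  have : ∑ j ∈ Finset.range Q, (4 : ℝ) ^ j * μ.real {x | (2 : ℝ) ^ j / 2 ≤ ‖G x‖}
      < ∑ j ∈ Finset.range Q, (3 / 4 / Q : ℝ) := by
    refine Finset.sum_lt_sum_of_nonempty (Finset.nonempty_range_iff.2 h0.ne') fun j hj => ?_
    have := hcon j (Finset.mem_range.1 hj)
    have h4 : (0 : ℝ) < 4 ^ j := by positivity
    calc _ < (4 : ℝ) ^ j * (3 / (4 * 4 ^ j * Q)) := by gcongr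
      _ = _ := by field_simp
  rw [Finset.sum_const, Finset.card_range, nsmul_eq_mul] at this
  have h2 : (Q : ℝ) * (3 / 4 / Q) = 3 / 4 := by field_simp
  linarith

/-- The nonnegative part of `a` in the direction `I ^ r`. -/
def dirPart (a : ℂ) (r : Fin 4) : ℝ := ![max a.re 0, max a.im 0, max (-a.re) 0, max (-a.im) 0] r

lemma dirPart_nonneg (a : ℂ) (r : Fin 4) : 0 ≤ dirPart a r := by
  fin_cases r <;> simp [dirPart]

lemma sum_dirPart_le (a : ℂ) : ∑ r, dirPart a r ≤ 2 * ‖a‖ := by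
  have h1 := Complex.abs_re_le_norm a
  have h2 := Complex.abs_im_le_norm a
  have h3 : ∀ y : ℝ, max y 0 + max (-y) 0 = |y| := by
    intro y
    rcases le_total 0 y with h | h
    · rw [max_eq_left h, max_eq_right (by linarith), abs_of_nonneg h, add_zero]
    · rw [max_eq_right h, max_eq_left (by linarith), abs_of_nonpos h, zero_add]
  have h4 := h3 a.re
  have h5 := h3 a.im
  simp [Fin.sum_univ_four, dirPart]
  linarith

lemma sum_dirPart_mul (a : ℂ) : ∑ r, (dirPart a r : ℂ) * Complex.I ^ (r : ℕ) = a := by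
  have h3 : ∀ y : ℝ, max y 0 - max (-y) 0 = y := by
    intro y
    rcases le_total 0 y with h | h
    · rw [max_eq_left h, max_eq_right (by linarith), sub_zero]
    · rw [max_eq_right h, max_eq_left (by linarith)]; ring
  rw [Fin.sum_univ_four]
  have e3 : Complex.I ^ 3 = -Complex.I := by rw [pow_succ, Complex.I_sq]; ring
  apply Complex.ext
  · simp [dirPart, e3]
    linarith [h3 a.re]
  · simp [dirPart, e3]
    linarith [h3 a.im]

lemma one_sub_indicator_half {X : Type*} (S : Set X) (x : X) :
    1 - S.indicator (fun _ => (1 / 2 : ℝ)) x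
      = Real.exp (-(Real.log 2 * S.indicator (fun _ => (1 : ℝ)) x)) := by
  by_cases h : x ∈ S
  · simp only [h, Set.indicator_of_mem, mul_one]
    rw [Real.exp_neg, Real.exp_log (by norm_num)]
    norm_num
  · simp [h]

/-- The dictionary atoms `I ^ r * φ k`, together with a zero atom. -/
def atom {X K : Type*} (φ : K → X → ℂ) : Option (K × Fin 4) → X → ℂ
  | none => fun _ => 0
  | some (k, r) => fun x => Complex.I ^ (r : ℕ) * φ k x

/-- The complexity of an atom. -/
def atomCost {K : Type*} (ℓ : K → ℝ) : Option (K × Fin 4) → ℝ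
  | none => 0
  | some (k, _) => ℓ k

lemma exp_two_ge_five : (5 : ℝ) ≤ Real.exp 2 := by
  have := Real.exp_one_gt_d9
  rw [show (2 : ℝ) = 1 + 1 by norm_num, Real.exp_add]
  nlinarith

lemma potential_term_le (a S H p : ℝ) (m : ℕ) (hp0 : 0 ≤ p) (hp1 : p ≤ 1) (ha : 0 ≤ a) (hH : 1 ≤ H)
    (hm : 7 * a * H ≤ m * p / 8) (hS : S ≤ 4 * a * H) :
    Real.exp (Real.log 2 * (m * p / 2)) * (1 - p / 2) ^ m ≤
      Real.exp (-(3 * a)) * Real.exp (-S) := by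
  have h2 : (1 - p / 2) ^ m ≤ Real.exp (-(m * p / 2)) := by
    have := Real.one_sub_le_exp_neg (p / 2)
    refine (pow_le_pow_left₀ (by linarith) this m).trans_eq ?_
    rw [← Real.exp_nat_mul]
    congr 1
    ring
  refine (mul_le_mul_of_nonneg_left h2 (Real.exp_pos _).le).trans ?_
  rw [← Real.exp_add, ← Real.exp_add]
  refine Real.exp_le_exp.2 ?_
  have h4 : Real.log 2 ≤ 3 / 4 := by linarith [Real.log_two_lt_d9]
  have h5 : 0 ≤ m * p := mul_nonneg (Nat.cast_nonneg _) hp0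
  have h7 : a ≤ a * H := le_mul_of_one_le_right ha hH
  have h9 := mul_le_mul_of_nonneg_right h4 (by linarith : 0 ≤ m * p / 2)
  linarith

lemma sum_tuples_lt_one {ι : Type*} [Fintype ι] (w : ι → ℝ) (hw0 : ∀ i, 0 ≤ w i)
    (hw : ∑ i, w i ≤ 5) (Q : ℕ) (L : ℕ → ℕ) (hL : ∀ j < Q, Real.exp (-(L j : ℝ)) < 1 / Q) :
    ∑ c : (Σ j : Fin Q, (Fin (L j) → ι)), Real.exp (-(3 * L c.1 : ℝ)) * ∏ l, w (c.2 l) < 1 := by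
  have key : ∀ j : Fin Q, ∑ t : Fin (L j) → ι, Real.exp (-(3 * L j : ℝ)) * ∏ l, w (t l) ≤
      Real.exp (-(L j : ℝ)) := by
    intro j
    have h6 : 0 ≤ ∑ i, w i := Finset.sum_nonneg fun i _ => hw0 i
    rw [← Finset.mul_sum, ← Fintype.sum_pow]
    refine (mul_le_mul_of_nonneg_left (pow_le_pow_left₀ h6 (hw.trans exp_two_ge_five) _)
      (Real.exp_pos _).le).trans_eq ?_
    rw [← Real.exp_nat_mul, ← Real.exp_add]
    congr 1
    ring
  rw [Fintype.sum_sigma]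
  rcases Nat.eq_zero_or_pos Q with h0 | h0
  · subst h0; simp
  have hQ : (0 : ℝ) < Q := by exact_mod_cast h0
  have h1 : ∑ j : Fin Q, Real.exp (-(L j : ℝ)) < ∑ j : Fin Q, (1 : ℝ) / Q :=
    Finset.sum_lt_sum_of_nonempty ⟨⟨0, h0⟩, Finset.mem_univ _⟩ fun j _ => hL j j.2
  have h2 : ∑ j : Fin Q, (1 : ℝ) / Q = 1 := by simp [hQ.ne']
  exact (Finset.sum_le_sum fun j _ => key j).trans_lt (h1.trans_eq h2)

/-- The union bound behind the choice of the sampling points. -/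
lemma sum_potential_lt_one {ι : Type*} [Fintype ι] (cost : ι → ℝ)
    (hcost : ∑ i, Real.exp (-cost i) ≤ 5) (H : ℝ) (hH : 1 ≤ H) (Q : ℕ) (L : ℕ → ℕ) (p : ℕ → ℝ)
    (m : ℕ) (hp0 : ∀ j, 0 ≤ p j) (hm : ∀ j < Q, 7 * L j * H ≤ m * p j / 8)
    (hL : ∀ j < Q, Real.exp (-(L j : ℝ)) < 1 / Q) (good : Finset (Σ j : Fin Q, (Fin (L j) → ι)))
    (hgood : ∀ c ∈ good, ∑ l, cost (c.2 l) ≤ 4 * L c.1 * H ∧ p c.1 ≤ 1) :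
    ∑ c ∈ good, Real.exp (Real.log 2 * (m * p c.1 / 2)) * (1 - p c.1 / 2) ^ m < 1 := by
  refine lt_of_le_of_lt ((Finset.sum_le_sum fun c hc => ?_).trans
    (Finset.sum_le_sum_of_subset_of_nonneg (Finset.subset_univ good) fun c _ _ =>
      mul_nonneg (Real.exp_pos _).le (Finset.prod_nonneg fun l _ => (Real.exp_pos _).le)))
    (sum_tuples_lt_one (fun i => Real.exp (-cost i)) (fun i => (Real.exp_pos _).le) hcost Q L hL)
  have := potential_term_le (L c.1) (∑ l, cost (c.2 l)) H (p c.1) m (hp0 _) (hgood c hc).2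
    (Nat.cast_nonneg _) hH (hm c.1 c.1.2) (hgood c hc).1
  rwa [← Finset.sum_neg_distrib, Real.exp_sum] at this

/-- Points at which every function with small weighted coefficient norm is detected. -/
theorem exists_detecting_points {X K : Type*} [MeasurableSpace X] [Fintype K] (μ : Measure X)
    [IsProbabilityMeasure μ] (D : Set X) (hD : μ Dᶜ = 0) (φ : K → X → ℂ)
    (hφm : ∀ k, Measurable (φ k)) (hφ : ∀ k x, ‖φ k x‖ ≤ 1) (v ℓ : K → ℝ) (hv0 : ∀ k, 0 ≤ v k)
    (hv1 : ∀ k, v k ≤ 1) (hℓ : ∀ k, 0 ≤ ℓ k) (hℓ1 : ∑ k, Real.exp (-ℓ k) ≤ 1) (H : ℝ) (hH : 1 ≤ H)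
    (hvℓ : ∀ k, v k * ℓ k ≤ H) (A : ℝ) (hA : 1 ≤ A) (Q : ℕ) (hAQ : A ≤ 2 ^ Q) (hQA : 2 ^ Q ≤ 16 * A)
    (L : ℕ → ℕ) (hL0 : ∀ j, 0 < L j)
    (hL : ∀ j < Q, 4 * Real.exp (-(L j * (2 ^ j / (8 * A)) ^ 2 / 64)) ≤
      3 / (4 * 4 ^ j * Q) / 16)
    (m : ℕ) (hm0 : 0 < m) (hm : ∀ j < Q, 7 * L j * H ≤ m * (3 / 4 * (3 / (4 * 4 ^ j * Q))) / 8) :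
    ∃ x : Fin m → X, (∀ i, x i ∈ D) ∧ ∀ α : K → ℂ, ∑ k, ‖α k‖ ≤ A / 2 →
      ∫ a, ‖∑ k, α k * v k * φ k a‖ ^ 2 ∂μ = 1 → ∃ i, 1 / 4 ≤ ‖∑ k, α k * v k * φ k (x i)‖ := by
  classical
  have hmR : (0 : ℝ) < m := by exact_mod_cast hm0
  have hLR : ∀ j, (0 : ℝ) < L j := fun j => by exact_mod_cast hL0 j
  have hatm : ∀ i, Measurable (atom φ i) := by
    rintro (_ | ⟨k, r⟩)
    · exact measurable_const
    · exact (hφm k).const_mul _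
  have hat1 : ∀ i a, ‖atom φ i a‖ ≤ 1 := by
    rintro (_ | ⟨k, r⟩) a
    · simp [atom]
    · simpa [atom] using hφ k a
  have hcost0 : ∀ i, 0 ≤ atomCost ℓ i := by
    rintro (_ | ⟨k, r⟩)
    · exact le_rfl
    · exact hℓ k
  have hcost5 : ∑ i, Real.exp (-atomCost ℓ i) ≤ 5 := by
    rw [Fintype.sum_option, Fintype.sum_prod_type]
    simp only [atomCost, Finset.sum_const, Finset.card_univ, Fintype.card_fin, nsmul_eq_mul,
      ← Finset.mul_sum]
    simp
    linarith
  set p : ℕ → ℝ := fun j => 3 / (4 * 4 ^ j * Q) with hp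
  -- the averages of atoms
  set S : (Σ j : Fin Q, (Fin (L j) → Option (K × Fin 4))) → X → ℂ :=
    fun c a => (A / L c.1 : ℝ) * ∑ l, atom φ (c.2 l) a with hS
  set E : (Σ j : Fin Q, (Fin (L j) → Option (K × Fin 4))) → Set X :=
    fun c => {a | 3 / 4 * (2 ^ (c.1 : ℕ) / 2) ≤ ‖S c a‖} with hE
  have hEm : ∀ c, MeasurableSet (E c) := by
    intro c
    refine measurableSet_le measurable_const (Measurable.norm ?_)
    exact (Finset.measurable_sum _ fun l _ => hatm _).const_mul _
  set good : Finset (Σ j : Fin Q, (Fin (L j) → Option (K × Fin 4))) :=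
    Finset.univ.filter fun c => ∑ l, atomCost ℓ (c.2 l) ≤ 4 * L c.1 * H ∧
      3 / 4 * p c.1 ≤ μ.real (E c) with hgood
  set W : (Σ j : Fin Q, (Fin (L j) → Option (K × Fin 4))) → ℝ :=
    fun c => Real.exp (Real.log 2 * (m * (3 / 4 * p c.1) / 2)) with hW
  obtain ⟨x, hxD, hx⟩ := exists_points μ good E hEm (fun c => 3 / 4 * p c.1)
    (fun c hc => (Finset.mem_filter.1 hc).2.2) D hD m W (fun c => (Real.exp_pos _).le)
  have hp0 : ∀ j, 0 ≤ p j := fun j => by simp only [hp]; positivity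
  have hlt : ∑ c ∈ good, W c * (1 - 3 / 4 * p c.1 / 2) ^ m < 1 := by
    refine sum_potential_lt_one (atomCost ℓ) hcost5 H hH Q L (fun j => 3 / 4 * p j) m
      (fun j => by have := hp0 j; linarith) hm (fun j hj => ?_) good (fun c hc => ?_)
    · have h1 := hL j hj
      have h2 : (2 : ℝ) ^ j ≤ 2 ^ Q := pow_le_pow_right₀ (by norm_num) hj.le
      have h3 : (2 : ℝ) ^ j / (8 * A) ≤ 2 := by
        rw [div_le_iff₀ (by linarith)]
        linarith
      have h4 : 0 ≤ (2 : ℝ) ^ j / (8 * A) := by positivity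
      have h5 : Real.exp (-(L j : ℝ)) ≤
          Real.exp (-(L j * (2 ^ j / (8 * A)) ^ 2 / 64)) := by
        refine Real.exp_le_exp.2 ?_
        have := hLR j
        have h6 : ((2 : ℝ) ^ j / (8 * A)) ^ 2 ≤ 64 := by nlinarith
        nlinarith [mul_le_mul_of_nonneg_left h6 this.le]
      have hQ : (0 : ℝ) < Q := by exact_mod_cast (Nat.zero_le j).trans_lt hj
      have h6 : (3 : ℝ) / (4 * 4 ^ j * Q) / 16 ≤ 3 / 64 * (1 / Q) := by
        have : (1 : ℝ) ≤ 4 ^ j := one_le_pow₀ (by norm_num)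
        rw [show (3 : ℝ) / (4 * 4 ^ j * Q) / 16 = 3 / 64 * (1 / (4 ^ j * Q)) by
          field_simp
          norm_num]
        refine mul_le_mul_of_nonneg_left (one_div_le_one_div_of_le hQ ?_) (by norm_num)
        exact le_mul_of_one_le_left hQ.le this
      have h7 : (0 : ℝ) < 1 / Q := by positivity
      linarith
    · obtain ⟨-, hc1, hc2⟩ := Finset.mem_filter.1 hc
      exact ⟨hc1, hc2.trans measureReal_le_one⟩
  refine ⟨x, hxD, fun α hα hα2 => ?_⟩
  set G : X → ℂ := fun a => ∑ k, α k * v k * φ k a with hG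
  have hGm : Measurable G := Finset.measurable_sum _ fun k _ => (hφm k).const_mul _
  have hGb : ∀ a, ‖G a‖ ≤ 2 ^ Q / 2 := by
    intro a
    refine (norm_sum_le _ _).trans (le_trans (Finset.sum_le_sum fun k _ => ?_) (hα.trans ?_))
    · rw [norm_mul, norm_mul, Complex.norm_real, Real.norm_of_nonneg (hv0 k)]
      calc _ ≤ ‖α k‖ * 1 * 1 := by gcongr; exacts [hv1 k, hφ k a]
        _ = _ := by ring
    · linarith
  obtain ⟨j, hjQ, hj⟩ := exists_dyadic_level μ G hGm Q hGb hα2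
  have hApos : (0 : ℝ) < A := by linarith
  -- the sampling distribution
  set q : Option (K × Fin 4) → ℝ := fun i => Option.elim i
    (1 - ∑ k, ∑ r, v k * dirPart (α k) r / A) (fun kr => v kr.1 * dirPart (α kr.1) kr.2 / A) with hq
  have hsumα : ∑ k, ∑ r, dirPart (α k) r ≤ A := by
    calc _ ≤ ∑ k, 2 * ‖α k‖ := Finset.sum_le_sum fun k _ => sum_dirPart_le _
      _ ≤ A := by rw [← Finset.mul_sum]; linarith
  have hq0 : ∀ i, 0 ≤ q i := by
    rintro (_ | ⟨k, r⟩)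
    · simp only [hq, Option.elim_none, sub_nonneg]
      calc _ ≤ ∑ k, ∑ r, dirPart (α k) r / A := by
            refine Finset.sum_le_sum fun k _ => Finset.sum_le_sum fun r _ => ?_
            gcongr
            exact mul_le_of_le_one_left (dirPart_nonneg _ _) (hv1 k)
        _ = (∑ k, ∑ r, dirPart (α k) r) / A := by simp only [Finset.sum_div]
        _ ≤ 1 := (div_le_one hApos).2 hsumα
    · exact div_nonneg (mul_nonneg (hv0 k) (dirPart_nonneg _ _)) hApos.le
  have hq1 : ∑ i, q i = 1 := by
    rw [Fintype.sum_option, Fintype.sum_prod_type]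
    simp [hq]
  have hmean : ∀ a, ∑ i, (q i : ℂ) * atom φ i a = G a / A := by
    intro a
    rw [Fintype.sum_option, Fintype.sum_prod_type]
    simp only [atom, mul_zero, zero_add, hG, Finset.sum_div]
    refine Finset.sum_congr rfl fun k _ => ?_
    conv_rhs => rw [← sum_dirPart_mul (α k)]
    simp only [Finset.sum_mul, Finset.sum_div, hq, Option.elim_some]
    refine Finset.sum_congr rfl fun r _ => ?_
    push_cast
    ring
  have hqℓ : ∑ i, q i * atomCost ℓ i ≤ H := by
    rw [Fintype.sum_option, Fintype.sum_prod_type]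
    simp only [atomCost, mul_zero, zero_add, hq, Option.elim_some]
    calc _ ≤ ∑ k, ∑ r, H * (dirPart (α k) r / A) := by
          refine Finset.sum_le_sum fun k _ => Finset.sum_le_sum fun r _ => ?_
          have := mul_le_mul_of_nonneg_right (hvℓ k)
            (div_nonneg (dirPart_nonneg (α k) r) hApos.le)
          calc _ = v k * ℓ k * (dirPart (α k) r / A) := by ring
            _ ≤ _ := this
      _ = H * ((∑ k, ∑ r, dirPart (α k) r) / A) := by simp only [Finset.mul_sum, Finset.sum_div]
      _ ≤ H := mul_le_of_le_one_right (by linarith) ((div_le_one hApos).2 hsumα)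
  have hQ : (0 : ℝ) < Q := by exact_mod_cast (Nat.zero_le j).trans_lt hjQ
  have hpj : 0 < p j := by simp only [hp]; positivity
  have hs1 : (2 : ℝ) ^ j / (8 * A) ≤ 1 := by
    rw [div_le_one (by linarith)]
    have : (2 : ℝ) ^ (j + 1) ≤ 2 ^ Q := pow_le_pow_right₀ (by norm_num) hjQ
    rw [pow_succ] at this
    linarith
  obtain ⟨τ, hτ1, hτ2, hτ3⟩ := exists_maurey_tuple μ (atom φ) hatm hat1 q hq0 hq1 (atomCost ℓ)
    hcost0 H (by linarith) hqℓ (L j) (hL0 j) (2 ^ j / (8 * A)) (by positivity) hs1 (p j / 16)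
    (by positivity) (hL j hjQ) m hm0 x
  set B : Set X := {a | (2 : ℝ) ^ j / (8 * A) * L j ≤
    ‖∑ l, (atom φ (τ l) a - ∑ i, (q i : ℂ) * atom φ i a)‖} with hB
  set c : (Σ j : Fin Q, (Fin (L j) → Option (K × Fin 4))) := ⟨⟨j, hjQ⟩, τ⟩ with hc
  have hnotB : ∀ a, a ∉ B → ‖S c a - G a‖ < 2 ^ j / 2 / 4 := by
    intro a ha
    have ha' : ‖∑ l, (atom φ (τ l) a - ∑ i, (q i : ℂ) * atom φ i a)‖
      < (2 : ℝ) ^ j / (8 * A) * L j := not_le.1 ha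
    have hLc : (L j : ℂ) ≠ 0 := by exact_mod_cast (hLR j).ne'
    have hAc : (A : ℂ) ≠ 0 := by exact_mod_cast hApos.ne'
    have : S c a - G a = (A / L j : ℝ) *
        ∑ l, (atom φ (τ l) a - ∑ i, (q i : ℂ) * atom φ i a) := by
      rw [Finset.sum_sub_distrib, hmean]
      simp only [hS, hc, Finset.sum_const, Finset.card_univ, Fintype.card_fin, nsmul_eq_mul]
      push_cast
      field_simp
    rw [this, norm_mul, Complex.norm_real, Real.norm_of_nonneg (div_nonneg hApos.le (hLR j).le)]
    calc _ < A / L j * ((2 : ℝ) ^ j / (8 * A) * L j) := by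
          gcongr
          exact div_pos hApos (hLR j)
      _ = _ := by
          have := (hLR j).ne'
          field_simp
          norm_num
  have hcgood : c ∈ good := by
    refine Finset.mem_filter.2 ⟨Finset.mem_univ _, hτ3, ?_⟩
    have hsub : {a | (2 : ℝ) ^ j / 2 ≤ ‖G a‖} ⊆ E c ∪ B := by
      intro a ha
      by_cases hb : a ∈ B
      · exact Or.inr hb
      · left
        have h1 := hnotB a hb
        have h2 : ‖G a‖ ≤ ‖S c a‖ + ‖S c a - G a‖ := by
          rw [norm_sub_rev]
          simpa using norm_add_le (S c a) (G a - S c a)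
        have h3 : (2 : ℝ) ^ j / 2 ≤ ‖G a‖ := ha
        show 3 / 4 * (2 ^ j / 2) ≤ ‖S c a‖
        linarith
    have h1 := (measureReal_mono (μ := μ) hsub).trans (measureReal_union_le _ _)
    have h2 : p j ≤ μ.real {a | (2 : ℝ) ^ j / 2 ≤ ‖G a‖} := hj
    show 3 / 4 * p j ≤ μ.real (E c)
    linarith
  by_contra! hcon
  have hEB : ∀ i, x i ∈ E c → x i ∈ B := by
    intro i hi
    by_contra hb
    have h1 := hnotB _ hb
    have h2 : ‖S c (x i)‖ ≤ ‖G (x i)‖ + ‖S c (x i) - G (x i)‖ := by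
      simpa using norm_add_le (G (x i)) (S c (x i) - G (x i))
    have h3 : 3 / 4 * (2 ^ j / 2) ≤ ‖S c (x i)‖ := hi
    have h4 := hcon i
    have h5 : (1 : ℝ) ≤ 2 ^ j := one_le_pow₀ (by norm_num)
    have h6 : ‖G (x i)‖ < 1 / 4 := h4
    linarith
  have hcount : ∑ i, (E c).indicator (fun _ => (1 : ℝ)) (x i) ≤ m * (3 / 4 * p j) / 2 := by
    have : ∑ i, (E c).indicator (fun _ => (1 : ℝ)) (x i) ≤
        ∑ i, B.indicator (fun _ => (1 : ℝ)) (x i) := by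
      refine Finset.sum_le_sum fun i _ => ?_
      by_cases hi : x i ∈ E c
      · simp [hi, hEB i hi]
      · simp only [hi, not_false_eq_true, Set.indicator_of_notMem]
        exact Set.indicator_nonneg (by simp) _
    have h2 := mul_pos hpj hmR
    linarith
  have hterm : 1 ≤ W c * ∏ i, (1 - (E c).indicator (fun _ => (1 / 2 : ℝ)) (x i)) := by
    simp only [one_sub_indicator_half]
    rw [← Real.exp_sum, Finset.sum_neg_distrib, ← Finset.mul_sum]
    simp only [hW]
    rw [← Real.exp_add]
    refine Real.one_le_exp ?_
    have := mul_le_mul_of_nonneg_left hcount (Real.log_nonneg (by norm_num : (1 : ℝ) ≤ 2))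
    simp only [hc] at this ⊢
    linarith
  have hle : W c * ∏ i, (1 - (E c).indicator (fun _ => (1 / 2 : ℝ)) (x i)) ≤
      ∑ c ∈ good, W c * ∏ i, (1 - (E c).indicator (fun _ => (1 / 2 : ℝ)) (x i)) := by
    refine Finset.single_le_sum (f := fun c => W c * ∏ i,
      (1 - (E c).indicator (fun _ => (1 / 2 : ℝ)) (x i))) (fun c _ => ?_) hcgood
    refine mul_nonneg (Real.exp_pos _).le (Finset.prod_nonneg fun i _ => ?_)
    rw [one_sub_indicator_half]
    exact (Real.exp_pos _).le
  linarith

/-- The univariate character `t ↦ e^{2π i k t}`. -/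
def chr (k : ℤ) (t : ℝ) : ℂ := Complex.exp (((2 * Real.pi * (k * t) : ℝ) : ℂ) * Complex.I)

lemma continuous_chr (k : ℤ) : Continuous (chr k) := by
  unfold chr
  fun_prop

lemma chr_zero (t : ℝ) : chr 0 t = 1 := by simp [chr]

lemma chr_add (k l : ℤ) (t : ℝ) : chr (k + l) t = chr k t * chr l t := by
  simp only [chr, ← Complex.exp_add]
  congr 1
  push_cast
  ring

lemma chr_neg (k : ℤ) (t : ℝ) : chr (-k) t = (starRingEnd ℂ) (chr k t) := by
  simp only [chr, ← Complex.exp_conj, map_mul, Complex.conj_I, Complex.conj_ofReal]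
  congr 1
  push_cast
  ring

lemma chr_sub_right (k : ℤ) (s t : ℝ) : chr k (s - t) = chr k s * chr (-k) t := by
  simp only [chr, ← Complex.exp_add]
  congr 1
  push_cast
  ring

lemma integral_chr (k : ℤ) : ∫ t in Set.Ico (0 : ℝ) 1, chr k t = if k = 0 then 1 else 0 := by
  split_ifs with h
  · subst h
    simp [chr_zero]
  · rw [integral_Ico_eq_integral_Ioo, ← integral_Ioc_eq_integral_Ioo,
      ← intervalIntegral.integral_of_le zero_le_one]
    have hc : ((2 * Real.pi * k : ℝ) : ℂ) * Complex.I ≠ 0 := by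
      refine mul_ne_zero ?_ Complex.I_ne_zero
      have : (2 * Real.pi * k : ℝ) ≠ 0 := by
        have : (k : ℝ) ≠ 0 := by exact_mod_cast h
        positivity
      exact_mod_cast this
    have : ∀ t : ℝ, chr k t = Complex.exp (((2 * Real.pi * k : ℝ) : ℂ) * Complex.I * t) := by
      intro t
      simp only [chr]
      congr 1
      push_cast
      ring
    simp only [this]
    rw [integral_exp_mul_complex hc]
    have h1 : Complex.exp (((2 * Real.pi * k : ℝ) : ℂ) * Complex.I * (1 : ℝ)) = 1 := by
      rw [Complex.exp_eq_one_iff]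
      exact ⟨k, by push_cast; ring⟩
    rw [h1]
    simp

lemma volume_restrict_cube (d : ℕ) : (volume.restrict (cube d) : Measure (Fin d → ℝ)) =
    Measure.pi fun _ => volume.restrict (Set.Ico (0 : ℝ) 1) := by
  rw [cube, volume_pi, Measure.restrict_pi_pi]

instance isProbabilityMeasure_unit : IsProbabilityMeasure (volume.restrict (Set.Ico (0 : ℝ) 1)) :=
  ⟨by simp⟩

instance isProbabilityMeasure_cube (d : ℕ) :
    IsProbabilityMeasure (volume.restrict (cube d) : Measure (Fin d → ℝ)) := by
  rw [volume_restrict_cube]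
  infer_instance

lemma measurableSet_cube (d : ℕ) : MeasurableSet (cube d) :=
  MeasurableSet.univ_pi fun _ => measurableSet_Ico

lemma integral_cube_prod {d : ℕ} (f : Fin d → ℝ → ℂ) :
    ∫ x in cube d, ∏ i, f i (x i) = ∏ i, ∫ t in Set.Ico (0 : ℝ) 1, f i t := by
  rw [volume_restrict_cube]
  exact integral_fintype_prod_eq_prod f

lemma integral_cube_prod_real {d : ℕ} (f : Fin d → ℝ → ℝ) :
    ∫ x in cube d, ∏ i, f i (x i) = ∏ i, ∫ t in Set.Ico (0 : ℝ) 1, f i t := by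
  rw [volume_restrict_cube]
  exact integral_fintype_prod_eq_prod f

lemma expk_eq_prod (d : ℕ) (k : Fin d → ℤ) (x : Fin d → ℝ) : expk d k x = ∏ i, chr (k i) (x i) := by
  simp only [expk, chr, ← Complex.exp_sum]
  congr 1
  push_cast
  rw [Finset.mul_sum, Finset.sum_mul]

lemma norm_expk (d : ℕ) (k : Fin d → ℤ) (x : Fin d → ℝ) : ‖expk d k x‖ = 1 :=
  Complex.norm_exp_ofReal_mul_I _

lemma continuous_expk (d : ℕ) (k : Fin d → ℤ) : Continuous (expk d k) := by
  unfold expk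
  fun_prop

lemma expk_add (d : ℕ) (k l : Fin d → ℤ) (x : Fin d → ℝ) :
    expk d (k + l) x = expk d k x * expk d l x := by
  simp only [expk_eq_prod, Pi.add_apply, chr_add, Finset.prod_mul_distrib]

lemma expk_neg (d : ℕ) (k : Fin d → ℤ) (x : Fin d → ℝ) :
    expk d (-k) x = (starRingEnd ℂ) (expk d k x) := by
  simp only [expk_eq_prod, Pi.neg_apply, chr_neg, map_prod]

lemma integral_expk (d : ℕ) (k : Fin d → ℤ) :
    ∫ x in cube d, expk d k x = if k = 0 then 1 else 0 := by
  simp only [expk_eq_prod]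
  rw [integral_cube_prod]
  simp only [integral_chr]
  split_ifs with h
  · simp [h]
  · obtain ⟨i, hi⟩ := Function.ne_iff.1 h
    exact Finset.prod_eq_zero (Finset.mem_univ i) (by simpa using hi)

lemma integrableOn_cube_of_continuous {d : ℕ} {E : Type*} [NormedAddCommGroup E]
    {f : (Fin d → ℝ) → E} (hf : Continuous f) : IntegrableOn f (cube d) := by
  refine (hf.continuousOn.integrableOn_compact (K := Set.univ.pi fun _ => Set.Icc (0 : ℝ) 1)
    (isCompact_univ_pi fun _ => isCompact_Icc)).mono_set ?_
  exact Set.pi_mono fun _ _ => Set.Ico_subset_Icc_self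

lemma continuous_trig {d : ℕ} (S : Finset (Fin d → ℤ)) (c : (Fin d → ℤ) → ℂ) :
    Continuous fun x => ∑ k ∈ S, c k * expk d k x :=
  continuous_finsetSum _ fun k _ => continuous_const.mul (continuous_expk d k)

lemma fCoeff_trig {d : ℕ} (S : Finset (Fin d → ℤ)) (c : (Fin d → ℤ) → ℂ) (l : Fin d → ℤ) :
    fCoeff d (fun x => ∑ k ∈ S, c k * expk d k x) l = if l ∈ S then c l else 0 := by
  classical
  unfold fCoeff
  have : ∀ x, (∑ k ∈ S, c k * expk d k x) * expk d (-l) x = ∑ k ∈ S, c k * expk d (k + -l) x := by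
    intro x
    rw [Finset.sum_mul]
    exact Finset.sum_congr rfl fun k _ => by rw [expk_add]; ring
  simp only [this]
  rw [integral_finsetSum (f := fun k x => c k * expk d (k + -l) x) _ fun k _ =>
    integrableOn_cube_of_continuous (continuous_const.mul (continuous_expk d _))]
  simp only [integral_const_mul, integral_expk, ← sub_eq_add_neg, sub_eq_zero]
  simp

lemma fCoeff_sub {d : ℕ} {f g : (Fin d → ℝ) → ℂ} (hf : Continuous f) (hg : Continuous g)
    (l : Fin d → ℤ) : fCoeff d (f - g) l = fCoeff d f l - fCoeff d g l := by
  unfold fCoeff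
  rw [← integral_sub (f := fun x => f x * expk d (-l) x) (g := fun x => g x * expk d (-l) x)
    (integrableOn_cube_of_continuous (hf.mul (continuous_expk d _)))
    (integrableOn_cube_of_continuous (hg.mul (continuous_expk d _)))]
  simp only [Pi.sub_apply, sub_mul]

lemma integral_mul_conj_trig {d : ℕ} {f : (Fin d → ℝ) → ℂ} (hf : Continuous f)
    (S : Finset (Fin d → ℤ)) (c : (Fin d → ℤ) → ℂ) :
    ∫ x in cube d, f x * (starRingEnd ℂ) (∑ k ∈ S, c k * expk d k x) =
      ∑ k ∈ S, fCoeff d f k * (starRingEnd ℂ) (c k) := by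
  have : ∀ x, f x * (starRingEnd ℂ) (∑ k ∈ S, c k * expk d k x) =
      ∑ k ∈ S, f x * expk d (-k) x * (starRingEnd ℂ) (c k) := by
    intro x
    rw [map_sum, Finset.mul_sum]
    exact Finset.sum_congr rfl fun k _ => by rw [map_mul, expk_neg]; ring
  simp only [this]
  rw [integral_finsetSum (f := fun k x => f x * expk d (-k) x * (starRingEnd ℂ) (c k)) _
    fun k _ => integrableOn_cube_of_continuous
      ((hf.mul (continuous_expk d _)).mul continuous_const)]
  simp only [integral_mul_const, fCoeff]

/-- Parseval's identity for trigonometric polynomials. -/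
lemma integral_norm_sq_trig {d : ℕ} (S : Finset (Fin d → ℤ)) (c : (Fin d → ℤ) → ℂ) :
    ∫ x in cube d, ‖∑ k ∈ S, c k * expk d k x‖ ^ 2 = ∑ k ∈ S, ‖c k‖ ^ 2 := by
  have h := integral_mul_conj_trig (continuous_trig S c) S c
  simp only [Complex.mul_conj'] at h
  have h2 : ∑ k ∈ S, fCoeff d (fun x => ∑ k ∈ S, c k * expk d k x) k * (starRingEnd ℂ) (c k) =
      ((∑ k ∈ S, ‖c k‖ ^ 2 : ℝ) : ℂ) := by
    push_cast
    refine Finset.sum_congr rfl fun k hk => ?_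
    rw [fCoeff_trig, if_pos hk, Complex.mul_conj']
  rw [h2] at h
  have h3 : ∫ x in cube d, ((‖∑ k ∈ S, c k * expk d k x‖ : ℝ) : ℂ) ^ 2 =
      ((∫ x in cube d, ‖∑ k ∈ S, c k * expk d k x‖ ^ 2 : ℝ) : ℂ) := by
    rw [← integral_complex_ofReal]
    push_cast
    rfl
  rw [h3] at h
  exact_mod_cast h

/-- Bessel's inequality. -/
lemma sum_norm_fCoeff_sq_le {d : ℕ} {h : (Fin d → ℝ) → ℂ} (hh : Continuous h) {e : ℝ}
    (he : ∀ x ∈ cube d, ‖h x‖ ≤ e) (S : Finset (Fin d → ℤ)) :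
    ∑ k ∈ S, ‖fCoeff d h k‖ ^ 2 ≤ e ^ 2 := by
  set g : (Fin d → ℝ) → ℂ := fun x => ∑ k ∈ S, fCoeff d h k * expk d k x with hg
  have hgc : Continuous g := continuous_trig S _
  have h1 := integral_mul_conj_trig hh S (fCoeff d h)
  have h2 : ∫ x in cube d, ‖g x‖ ^ 2 = ∑ k ∈ S, ‖fCoeff d h k‖ ^ 2 := integral_norm_sq_trig S _
  have h3 : ‖∫ x in cube d, h x * (starRingEnd ℂ) (g x)‖ = ∑ k ∈ S, ‖fCoeff d h k‖ ^ 2 := by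
    rw [h1]
    simp only [Complex.mul_conj']
    rw [show (∑ k ∈ S, (‖fCoeff d h k‖ : ℂ) ^ 2) = ((∑ k ∈ S, ‖fCoeff d h k‖ ^ 2 : ℝ) : ℂ) by
      push_cast; rfl, Complex.norm_real, Real.norm_of_nonneg (by positivity)]
  have h4 : ‖∫ x in cube d, h x * (starRingEnd ℂ) (g x)‖ ≤
      ∫ x in cube d, (e ^ 2 / 2 + ‖g x‖ ^ 2 / 2) := by
    refine norm_integral_le_of_norm_le (integrableOn_cube_of_continuous (by fun_prop)) ?_
    refine ae_restrict_of_forall_mem (measurableSet_cube d) fun x hx => ?_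
    rw [norm_mul, RCLike.norm_conj]
    have := he x hx
    nlinarith [sq_nonneg (‖h x‖ - ‖g x‖), norm_nonneg (h x)]
  rw [integral_add (integrable_const _) (integrableOn_cube_of_continuous (by fun_prop)),
    integral_const, integral_div, h2, h3] at h4
  simp at h4
  linarith

/-- The Dirichlet type sum `∑_{0 ≤ j < N} e^{2π i j z}`. -/
def dirSum (N : ℕ) (z : ℝ) : ℂ := ∑ j ∈ Finset.Ico (0 : ℤ) N, chr j z

lemma continuous_dirSum (N : ℕ) : Continuous (dirSum N) :=
  continuous_finsetSum _ fun _ _ => continuous_chr _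

lemma card_sub_eq (N : ℕ) (k : ℤ) :
    (((Finset.Ico (0 : ℤ) N ×ˢ Finset.Ico (0 : ℤ) N).filter fun p => p.1 - p.2 = k).card : ℝ) =
      max ((N : ℝ) - |(k : ℝ)|) 0 := by
  have h1 : ((Finset.Ico (0 : ℤ) N ×ˢ Finset.Ico (0 : ℤ) N).filter fun p => p.1 - p.2 = k) =
      (Finset.Ico (max 0 (-k)) (min (N : ℤ) (N - k))).image fun j => (j + k, j) := by
    ext ⟨i, j⟩
    simp only [Finset.mem_filter, Finset.mem_product, Finset.mem_Ico, Finset.mem_image,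
      Prod.mk.injEq]
    constructor
    · rintro ⟨⟨⟨h1, h2⟩, h3, h4⟩, h5⟩
      exact ⟨j, by omega, by omega, rfl⟩
    · rintro ⟨a, h1, h2, rfl⟩
      omega
  rw [h1, Finset.card_image_of_injective _ fun a b h => (Prod.mk.inj h).2, Int.card_Ico]
  have h2 : min (N : ℤ) (N - k) - max 0 (-k) = N - |k| := by
    rcases abs_cases k with ⟨h, h'⟩ | ⟨h, h'⟩ <;> omega
  rw [h2]
  have h3 : (((N - |k|).toNat : ℤ) : ℝ) = ((max (N - |k|) 0 : ℤ) : ℝ) := by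
    rw [Int.toNat_eq_max]
  rw [Int.cast_natCast] at h3
  rw [h3]
  push_cast
  rfl

/-- The Fourier expansion of the unnormalized Fejér kernel. -/
lemma norm_sq_dirSum (N b : ℕ) (hb : N ≤ b) (z : ℝ) :
    ((‖dirSum N z‖ ^ 2 : ℝ) : ℂ) =
      ∑ k ∈ Finset.Icc (-(b : ℤ)) b, ((max ((N : ℝ) - |(k : ℝ)|) 0 : ℝ) : ℂ) * chr k z := by
  have h1 : ((‖dirSum N z‖ ^ 2 : ℝ) : ℂ) =
      ∑ p ∈ Finset.Ico (0 : ℤ) N ×ˢ Finset.Ico (0 : ℤ) N, chr (p.1 - p.2) z := by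
    push_cast
    rw [← Complex.mul_conj', dirSum, map_sum, Finset.sum_mul_sum, Finset.sum_product]
    refine Finset.sum_congr rfl fun i _ => Finset.sum_congr rfl fun j _ => ?_
    rw [sub_eq_add_neg, chr_add, chr_neg]
  have hmaps : ∀ p ∈ Finset.Ico (0 : ℤ) N ×ˢ Finset.Ico (0 : ℤ) N,
      p.1 - p.2 ∈ Finset.Icc (-(b : ℤ)) b := by
    rintro ⟨i, j⟩ hp
    simp only [Finset.mem_product, Finset.mem_Ico, Finset.mem_Icc] at hp ⊢
    omega
  rw [h1, ← Finset.sum_fiberwise_of_maps_to hmaps]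
  refine Finset.sum_congr rfl fun k _ => ?_
  rw [← card_sub_eq, Complex.ofReal_natCast, ← nsmul_eq_mul, ← Finset.sum_const]
  refine Finset.sum_congr rfl fun p hp => ?_
  rw [(Finset.mem_filter.1 hp).2]

lemma integral_norm_sq_dirSum (N : ℕ) (s : ℝ) :
    ∫ t in Set.Ico (0 : ℝ) 1, ‖dirSum N (s - t)‖ ^ 2 = N := by
  have hintg : ∀ k : ℤ, IntegrableOn (fun t => ((max ((N : ℝ) - |(k : ℝ)|) 0 : ℝ) : ℂ) *
      chr k (s - t)) (Set.Ico (0 : ℝ) 1) := fun k =>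
    ((continuous_const.mul ((continuous_chr k).comp (continuous_const.sub continuous_id))
      ).integrableOn_Icc).mono_set Set.Ico_subset_Icc_self
  have h : ((∫ t in Set.Ico (0 : ℝ) 1, ‖dirSum N (s - t)‖ ^ 2 : ℝ) : ℂ) = N := by
    rw [← integral_complex_ofReal]
    simp only [norm_sq_dirSum N N le_rfl]
    rw [integral_finsetSum _ fun k _ => hintg k]
    simp only [chr_sub_right, integral_const_mul, integral_chr, neg_eq_zero]
    rw [Finset.sum_eq_single 0]
    · simp [chr_zero]
    · intro k _ hk
      simp [hk]
    · simp
  exact_mod_cast h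

/-- The univariate de la Vallée Poussin multiplier. -/
def vp1 (a b : ℕ) (k : ℤ) : ℝ :=
  (max ((b : ℝ) - |(k : ℝ)|) 0 - max ((a : ℝ) - |(k : ℝ)|) 0) / (b - a)

/-- The univariate de la Vallée Poussin kernel. -/
def vpKer (a b : ℕ) (z : ℝ) : ℝ := (‖dirSum b z‖ ^ 2 - ‖dirSum a z‖ ^ 2) / (b - a)

lemma vpKer_eq (a b : ℕ) (hab : a ≤ b) (z : ℝ) :
    (vpKer a b z : ℂ) = ∑ k ∈ Finset.Icc (-(b : ℤ)) b, (vp1 a b k : ℂ) * chr k z := by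
  unfold vpKer vp1
  rw [Complex.ofReal_div, Complex.ofReal_sub, norm_sq_dirSum b b le_rfl, norm_sq_dirSum a b hab,
    ← Finset.sum_sub_distrib, Finset.sum_div]
  refine Finset.sum_congr rfl fun k _ => ?_
  push_cast
  ring

lemma continuous_vpKer (a b : ℕ) : Continuous (vpKer a b) := by
  have := continuous_dirSum a
  have := continuous_dirSum b
  unfold vpKer
  fun_prop

lemma integral_abs_vpKer_le (a b : ℕ) (hab : a < b) (s : ℝ) :
    ∫ t in Set.Ico (0 : ℝ) 1, |vpKer a b (s - t)| ≤ (b + a) / (b - a) := by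
  have hpos : (0 : ℝ) < b - a := sub_pos.2 (by exact_mod_cast hab)
  have hintg : ∀ N : ℕ, IntegrableOn (fun t => ‖dirSum N (s - t)‖ ^ 2) (Set.Ico (0 : ℝ) 1) :=
    fun N => ((((continuous_dirSum N).comp (continuous_const.sub continuous_id)).norm.pow 2
      ).integrableOn_Icc).mono_set Set.Ico_subset_Icc_self
  calc ∫ t in Set.Ico (0 : ℝ) 1, |vpKer a b (s - t)|
      ≤ ∫ t in Set.Ico (0 : ℝ) 1,
        (‖dirSum b (s - t)‖ ^ 2 + ‖dirSum a (s - t)‖ ^ 2) / (b - a) := by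
        refine integral_mono_of_nonneg (Filter.Eventually.of_forall fun t => abs_nonneg _)
          (((hintg b).add (hintg a)).div_const _) (Filter.Eventually.of_forall fun t => ?_)
        simp only [vpKer, abs_div, abs_of_pos hpos]
        gcongr
        rw [abs_le]
        constructor <;> nlinarith [sq_nonneg ‖dirSum b (s - t)‖, sq_nonneg ‖dirSum a (s - t)‖]
    _ = _ := by
        rw [integral_div, integral_add (hintg b) (hintg a), integral_norm_sq_dirSum,
          integral_norm_sq_dirSum]

/-- The frequency box of the de la Vallée Poussin operator. -/
def vpBox (d M : ℕ) : Finset (Fin d → ℤ) :=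
  Fintype.piFinset fun _ => Finset.Icc (-(((d + 1) * M : ℕ) : ℤ)) ((d + 1) * M : ℕ)

/-- The multivariate de la Vallée Poussin multiplier. -/
def vpW (d M : ℕ) (k : Fin d → ℤ) : ℝ := ∏ i, vp1 M ((d + 1) * M) (k i)

/-- The de la Vallée Poussin operator. -/
def vpSum (d M : ℕ) (h : (Fin d → ℝ) → ℂ) (x : Fin d → ℝ) : ℂ :=
  ∑ k ∈ vpBox d M, fCoeff d h k * vpW d M k * expk d k x

lemma prod_vpKer_eq (d M : ℕ) (x y : Fin d → ℝ) :
    ((∏ i, vpKer M ((d + 1) * M) (x i - y i) : ℝ) : ℂ) =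
      ∑ k ∈ vpBox d M, (vpW d M k : ℂ) * expk d k x * expk d (-k) y := by
  push_cast
  have hle : M ≤ (d + 1) * M := Nat.le_mul_of_pos_left _ (Nat.succ_pos d)
  simp only [vpKer_eq M ((d + 1) * M) hle]
  rw [Finset.prod_univ_sum]
  refine Finset.sum_congr rfl fun k _ => ?_
  simp only [vpW, Finset.prod_mul_distrib, chr_sub_right, expk_eq_prod, Pi.neg_apply]
  push_cast
  ring

lemma vpSum_eq_integral (d M : ℕ) {h : (Fin d → ℝ) → ℂ} (hh : Continuous h) (x : Fin d → ℝ) :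
    vpSum d M h x =
      ∫ y in cube d, h y * ((∏ i, vpKer M ((d + 1) * M) (x i - y i) : ℝ) : ℂ) := by
  simp only [prod_vpKer_eq, Finset.mul_sum]
  rw [integral_finsetSum (f := fun k y => h y * ((vpW d M k : ℂ) * expk d k x * expk d (-k) y)) _
    fun k _ => integrableOn_cube_of_continuous
      (hh.mul (continuous_const.mul (continuous_expk d _)))]
  refine Finset.sum_congr rfl fun k _ => ?_
  rw [fCoeff, mul_assoc, ← integral_mul_const]
  congr 1
  funext y
  ring

lemma one_add_two_div_pow_le (d : ℕ) (hd : 1 ≤ d) : (1 + 2 / (d : ℝ)) ^ d ≤ 8 := by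
  have hd' : (0 : ℝ) < d := by exact_mod_cast hd
  have h1 : (1 + 2 / (d : ℝ)) ^ d ≤ Real.exp (2 / d) ^ d :=
    pow_le_pow_left₀ (by positivity) (by linarith [Real.add_one_le_exp (2 / (d : ℝ))]) d
  rw [← Real.exp_nat_mul, mul_div_cancel₀ _ hd'.ne'] at h1
  refine h1.trans ?_
  have := Real.exp_one_lt_d9
  rw [show (2 : ℝ) = 1 + 1 by norm_num, Real.exp_add]
  nlinarith [Real.exp_pos 1]

/-- The de la Vallée Poussin operator is bounded on `L_∞`. -/
lemma norm_vpSum_le (d M : ℕ) (hd : 1 ≤ d) (hM : 1 ≤ M) {h : (Fin d → ℝ) → ℂ} (hh : Continuous h)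
    {e : ℝ} (he0 : 0 ≤ e) (he : ∀ x ∈ cube d, ‖h x‖ ≤ e) (x : Fin d → ℝ) :
    ‖vpSum d M h x‖ ≤ 8 * e := by
  have hd' : (0 : ℝ) < d := by exact_mod_cast hd
  have hM' : (0 : ℝ) < M := by exact_mod_cast hM
  have hker := continuous_vpKer M ((d + 1) * M)
  rw [vpSum_eq_integral d M hh]
  have h1 : ‖∫ y in cube d, h y * ((∏ i, vpKer M ((d + 1) * M) (x i - y i) : ℝ) : ℂ)‖ ≤
      ∫ y in cube d, e * ∏ i, |vpKer M ((d + 1) * M) (x i - y i)| := by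
    refine norm_integral_le_of_norm_le (integrableOn_cube_of_continuous (by fun_prop)) ?_
    refine ae_restrict_of_forall_mem (measurableSet_cube d) fun y hy => ?_
    rw [norm_mul, Complex.norm_real, norm_prod]
    simp only [Real.norm_eq_abs]
    exact mul_le_mul_of_nonneg_right (he y hy) (Finset.prod_nonneg fun i _ => abs_nonneg _)
  rw [integral_const_mul,
    integral_cube_prod_real fun i t => |vpKer M ((d + 1) * M) (x i - t)|] at h1
  refine h1.trans ?_
  rw [mul_comm]
  refine mul_le_mul_of_nonneg_right ?_ he0
  refine (Finset.prod_le_prod (fun i _ => integral_nonneg fun t => abs_nonneg _) fun i _ =>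
    integral_abs_vpKer_le M ((d + 1) * M) (by nlinarith) (x i)).trans ?_
  rw [Finset.prod_const, Finset.card_univ, Fintype.card_fin]
  have h2 : ((((d + 1) * M : ℕ) : ℝ) + M) / ((((d + 1) * M : ℕ) : ℝ) - M) = 1 + 2 / d := by
    push_cast
    rw [show ((d : ℝ) + 1) * M - M = d * M by ring]
    field_simp
    ring
  rw [h2]
  exact one_add_two_div_pow_le d hd

lemma vp1_nonneg {a b : ℕ} (hab : a < b) (k : ℤ) : 0 ≤ vp1 a b k := by
  have hpos : (a : ℝ) < b := by exact_mod_cast hab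
  refine div_nonneg (sub_nonneg.2 (max_le_max (by linarith) le_rfl)) (by linarith)

lemma vp1_eq_one {a b : ℕ} (hab : a < b) {k : ℤ} (hk : |k| ≤ a) : vp1 a b k = 1 := by
  have hpos : (a : ℝ) < b := by exact_mod_cast hab
  have hk' : |(k : ℝ)| ≤ a := by exact_mod_cast hk
  rw [vp1, max_eq_left (by linarith), max_eq_left (by linarith)]
  rw [div_eq_one_iff_eq (by linarith)]
  ring

lemma vp1_le_exp {a b : ℕ} (hab : a < b) (k : ℤ) :
    vp1 a b k ≤ Real.exp (-(max (|(k : ℝ)| - a) 0 / (b - a))) := by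
  have hpos : (a : ℝ) < b := by exact_mod_cast hab
  rcases le_total |(k : ℝ)| a with h | h
  · rw [vp1_eq_one hab (by exact_mod_cast h), max_eq_right (by linarith)]
    simp
  · rcases le_total |(k : ℝ)| b with h' | h'
    · rw [vp1, max_eq_left (a := |(k : ℝ)| - a) (by linarith), max_eq_right (a := a - |(k : ℝ)|)
        (by linarith), max_eq_left (by linarith)]
      refine le_trans (le_of_eq ?_) (Real.one_sub_le_exp_neg _)
      rw [eq_sub_iff_add_eq, ← add_div, div_eq_one_iff_eq (by linarith)]
      ring
    · rw [vp1, max_eq_right (by linarith), max_eq_right (by linarith)]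
      simp only [sub_self, zero_div]
      exact (Real.exp_pos _).le

lemma vpSum_of_mem_boxPoly {d M : ℕ} (hd : 1 ≤ d) (hM : 1 ≤ M) {g : (Fin d → ℝ) → ℂ}
    (hg : g ∈ boxPoly d M) (x : Fin d → ℝ) : vpSum d M g x = g x := by
  obtain ⟨Λ, a, hΛ, rfl⟩ := hg
  have hlt : M < (d + 1) * M := by nlinarith
  have hsub : Λ ⊆ vpBox d M := by
    intro k hk
    refine Fintype.mem_piFinset.2 fun i => Finset.mem_Icc.2 ?_
    have := abs_le.1 (hΛ k hk i)
    have hlt' : (M : ℤ) < ((d + 1) * M : ℕ) := by exact_mod_cast hlt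
    constructor <;> linarith [this.1, this.2]
  simp only [vpSum, fCoeff_trig]
  rw [← Finset.sum_subset hsub fun k _ hk => by simp [hk]]
  refine Finset.sum_congr rfl fun k hk => ?_
  have : vpW d M k = 1 := Finset.prod_eq_one fun i _ => vp1_eq_one hlt (hΛ k hk i)
  simp [hk, this]

lemma vpSum_sub (d M : ℕ) {f g : (Fin d → ℝ) → ℂ} (hf : Continuous f) (hg : Continuous g)
    (x : Fin d → ℝ) : vpSum d M (f - g) x = vpSum d M f x - vpSum d M g x := by
  simp only [vpSum, fCoeff_sub hf hg, sub_mul, Finset.sum_sub_distrib]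

lemma continuous_of_mem_boxPoly {d M : ℕ} {g : (Fin d → ℝ) → ℂ} (hg : g ∈ boxPoly d M) :
    Continuous g := by
  obtain ⟨Λ, a, -, rfl⟩ := hg
  exact continuous_trig Λ a

/-- Near-best approximation by the de la Vallée Poussin operator. -/
lemma norm_sub_vpSum_le {d M : ℕ} (hd : 1 ≤ d) (hM : 1 ≤ M) {f g : (Fin d → ℝ) → ℂ}
    (hf : Continuous f) (hg : g ∈ boxPoly d M) {e : ℝ} (he0 : 0 ≤ e)
    (he : ∀ x ∈ cube d, ‖f x - g x‖ ≤ e) (x : Fin d → ℝ) (hx : x ∈ cube d) :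
    ‖f x - vpSum d M f x‖ ≤ 9 * e := by
  have hgc := continuous_of_mem_boxPoly hg
  have h1 := norm_vpSum_le d M hd hM (hf.sub hgc) he0 he x
  rw [vpSum_sub d M hf hgc, vpSum_of_mem_boxPoly hd hM hg] at h1
  have h2 := norm_sub_le (f x - g x) (vpSum d M f x - g x)
  rw [sub_sub_sub_cancel_right] at h2
  linarith [he x hx]

lemma sum_range_exp_le (M : ℕ) (hM : 1 ≤ M) (N : ℕ) :
    ∑ j ∈ Finset.range N, Real.exp (-(max ((j : ℝ) - M) 0 / M)) ≤ 2 * M + 1 := by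
  have hM' : (0 : ℝ) < M := by exact_mod_cast hM
  have key : ∀ N : ℕ, ∑ j ∈ Finset.range (M + 1 + N), Real.exp (-(max ((j : ℝ) - M) 0 / M)) ≤
      M + 1 + M * (1 - Real.exp (-(N / M : ℝ))) := by
    intro N
    induction N with
    | zero =>
      refine (Finset.sum_le_sum (g := fun _ => (1 : ℝ)) fun j _ => ?_).trans (by simp)
      exact Real.exp_le_one_iff.2 (neg_nonpos.2 (by positivity))
    | succ N ih =>
      rw [← add_assoc, Finset.sum_range_succ]
      have h1 : max (((M + 1 + N : ℕ) : ℝ) - M) 0 = N + 1 := by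
        push_cast
        rw [max_eq_left] <;> linarith [(Nat.cast_nonneg N : (0 : ℝ) ≤ N)]
      rw [h1]
      push_cast
      have h2 : Real.exp (-(N / M : ℝ)) = Real.exp (-((N + 1) / M : ℝ)) * Real.exp (1 / M) := by
        rw [← Real.exp_add]
        congr 1
        ring
      have h3 := Real.add_one_le_exp (1 / M : ℝ)
      have h4 := mul_le_mul_of_nonneg_left h3 (Real.exp_pos (-((N + 1) / M : ℝ))).le
      have h5 := mul_le_mul_of_nonneg_left h4 hM'.le
      rw [← h2] at h5
      have h6 : (M : ℝ) * (Real.exp (-((N + 1) / M : ℝ)) * (1 / M + 1)) =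
          Real.exp (-((N + 1) / M : ℝ)) + M * Real.exp (-((N + 1) / M : ℝ)) := by
        field_simp
      linarith
  calc _ ≤ ∑ j ∈ Finset.range (M + 1 + N), Real.exp (-(max ((j : ℝ) - M) 0 / M)) :=
        Finset.sum_le_sum_of_subset_of_nonneg (Finset.range_mono (by omega))
          fun _ _ _ => (Real.exp_pos _).le
    _ ≤ _ := key N
    _ ≤ _ := by nlinarith [Real.exp_pos (-(N / M : ℝ))]

lemma sum_Icc_exp_le (M : ℕ) (hM : 1 ≤ M) (b : ℕ) :
    ∑ k ∈ Finset.Icc (-(b : ℤ)) b, Real.exp (-(max (|(k : ℝ)| - M) 0 / M)) ≤ 5 * M := by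
  have hM' : (1 : ℝ) ≤ M := by exact_mod_cast hM
  rw [Finset.sum_Icc_of_even_eq_range (f := fun k : ℤ => Real.exp (-(max (|(k : ℝ)| - M) 0 / M)))
    (fun k => by simp) b]
  have h := sum_range_exp_le M hM (b + 1)
  have h0 : max (-(M : ℝ)) 0 = 0 := max_eq_right (by linarith)
  simp only [Int.cast_natCast, Nat.abs_cast, Int.cast_zero, abs_zero, zero_sub, h0]
  simp only [nsmul_eq_mul]
  simp
  linarith

/-- The complexities of the frequencies. -/
def vpEll (d M : ℕ) (k : Fin d → ℤ) : ℝ :=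
  d * Real.log (5 * M) + ∑ i, max (|(k i : ℝ)| - M) 0 / M

lemma log_five_mul_nonneg {M : ℕ} (hM : 1 ≤ M) : 0 ≤ Real.log (5 * M) := by
  have hM' : (1 : ℝ) ≤ M := by exact_mod_cast hM
  exact Real.log_nonneg (by linarith)

lemma vpEll_nonneg (d : ℕ) {M : ℕ} (hM : 1 ≤ M) (k : Fin d → ℤ) : 0 ≤ vpEll d M k :=
  add_nonneg (mul_nonneg (Nat.cast_nonneg _) (log_five_mul_nonneg hM))
    (Finset.sum_nonneg fun i _ => by positivity)

lemma sum_exp_neg_vpEll_le (d : ℕ) {M : ℕ} (hM : 1 ≤ M) :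
    ∑ k ∈ vpBox d M, Real.exp (-vpEll d M k) ≤ 1 := by
  have hM' : (1 : ℝ) ≤ M := by exact_mod_cast hM
  have h1 : ∀ k : Fin d → ℤ, Real.exp (-vpEll d M k) =
      (5 * M : ℝ)⁻¹ ^ d * ∏ i, Real.exp (-(max (|(k i : ℝ)| - M) 0 / M)) := by
    intro k
    rw [vpEll, neg_add, Real.exp_add, ← Finset.sum_neg_distrib, Real.exp_sum, ← mul_neg,
      Real.exp_nat_mul, Real.exp_neg, Real.exp_log (by positivity)]
  simp only [h1]
  rw [← Finset.mul_sum, vpBox,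
    ← Finset.prod_univ_sum (fun _ : Fin d => Finset.Icc (-(((d + 1) * M : ℕ) : ℤ))
      ((d + 1) * M : ℕ)) (fun _ k => Real.exp (-(max (|(k : ℝ)| - M) 0 / M))),
    Finset.prod_const, Finset.card_univ, Fintype.card_fin, ← mul_pow]
  refine pow_le_one₀ (mul_nonneg (by positivity)
    (Finset.sum_nonneg fun _ _ => (Real.exp_pos _).le)) ?_
  rw [inv_mul_le_iff₀ (by positivity), mul_one]
  exact sum_Icc_exp_le M hM _

lemma vpW_nonneg {d M : ℕ} (hd : 1 ≤ d) (hM : 1 ≤ M) (k : Fin d → ℤ) : 0 ≤ vpW d M k :=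
  Finset.prod_nonneg fun _ _ => vp1_nonneg (by nlinarith) _

lemma vpW_le_exp {d M : ℕ} (hd : 1 ≤ d) (hM : 1 ≤ M) (k : Fin d → ℤ) :
    vpW d M k ≤ Real.exp (-((∑ i, max (|(k i : ℝ)| - M) 0 / M) / d)) := by
  have hd' : (0 : ℝ) < d := by exact_mod_cast hd
  have hM' : (0 : ℝ) < M := by exact_mod_cast hM
  rw [Finset.sum_div, ← Finset.sum_neg_distrib, Real.exp_sum]
  refine Finset.prod_le_prod (fun i _ => vp1_nonneg (by nlinarith) _) fun i _ =>
    (vp1_le_exp (by nlinarith) (k i)).trans_eq ?_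
  congr 2
  push_cast
  rw [show ((d : ℝ) + 1) * M - M = M * d by ring, div_div]

lemma vpW_le_one {d M : ℕ} (hd : 1 ≤ d) (hM : 1 ≤ M) (k : Fin d → ℤ) : vpW d M k ≤ 1 := by
  refine (vpW_le_exp hd hM k).trans (Real.exp_le_one_iff.2 (neg_nonpos.2 ?_))
  exact div_nonneg (Finset.sum_nonneg fun i _ => by positivity) (Nat.cast_nonneg _)

lemma vpW_mul_vpEll_le {d M : ℕ} (hd : 1 ≤ d) (hM : 1 ≤ M) (k : Fin d → ℤ) :
    vpW d M k * vpEll d M k ≤ d * (Real.log (5 * M) + 1) := by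
  have hd' : (0 : ℝ) < d := by exact_mod_cast hd
  set t := ∑ i, max (|(k i : ℝ)| - M) 0 / M with ht
  have ht0 : 0 ≤ t := Finset.sum_nonneg fun i _ => by positivity
  have h1 : vpW d M k * t ≤ d := by
    calc _ ≤ Real.exp (-(t / d)) * t := mul_le_mul_of_nonneg_right (vpW_le_exp hd hM k) ht0
      _ = d * (t / d * Real.exp (-(t / d))) := by field_simp
      _ ≤ d * 1 := by
        refine mul_le_mul_of_nonneg_left ?_ hd'.le
        rw [Real.exp_neg, ← div_eq_mul_inv, div_le_one (Real.exp_pos _)]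
        linarith [Real.add_one_le_exp (t / d)]
      _ = d := mul_one _
  have h2 : vpW d M k * (d * Real.log (5 * M)) ≤ d * Real.log (5 * M) :=
    mul_le_of_le_one_left (mul_nonneg hd'.le (log_five_mul_nonneg hM)) (vpW_le_one hd hM k)
  rw [vpEll, mul_add]
  linarith

/-- Essential bounds of continuous functions hold everywhere on the cube. -/
lemma norm_le_of_LqNorm_top {d : ℕ} {h : (Fin d → ℝ) → ℂ} (hh : Continuous h)
    (hfin : LqNorm d ∞ h ≠ ∞) (x : Fin d → ℝ) (hx : x ∈ cube d) :
    ‖h x‖ ≤ (LqNorm d ∞ h).toReal := by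
  set e := (LqNorm d ∞ h).toReal with he
  have hae : ∀ᵐ x ∂volume.restrict (cube d), ‖h x‖ ≤ e := by
    have := ae_le_eLpNormEssSup (f := h) (μ := volume.restrict (cube d))
    filter_upwards [this] with x hx
    rw [he, LqNorm, eLpNorm_exponent_top]
    rw [LqNorm, eLpNorm_exponent_top] at hfin
    rw [← toReal_enorm]
    exact ENNReal.toReal_mono hfin hx
  have hae' : (fun x => max ‖h x‖ e) =ᵐ[volume.restrict (Set.univ.pi fun _ => Set.Ioo (0 : ℝ) 1)]
      fun _ : Fin d → ℝ => e := by
    filter_upwards [ae_restrict_of_ae_restrict_of_subset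
      (Set.pi_mono fun _ _ => Set.Ioo_subset_Ico_self) hae] with x hx
    exact max_eq_right hx
  have hU : IsOpen (Set.univ.pi fun _ : Fin d => Set.Ioo (0 : ℝ) 1) :=
    isOpen_set_pi Set.finite_univ fun _ _ => isOpen_Ioo
  have h1 := Measure.eqOn_open_of_ae_eq hae' hU (hh.norm.max continuous_const).continuousOn
    continuousOn_const
  have h2 := h1.closure (hh.norm.max continuous_const) continuous_const
  have hx' : x ∈ closure (Set.univ.pi fun _ : Fin d => Set.Ioo (0 : ℝ) 1) := by
    rw [closure_pi_set]
    intro i _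
    rw [closure_Ioo zero_ne_one]
    exact Set.Ico_subset_Icc_self (hx i trivial)
  have := h2 hx'
  exact max_eq_right_iff.1 this

lemma one_le_logStar (n : ℕ) : 1 ≤ logStar n := le_max_right _ _

/-- The number of dyadic levels needed for sparsity `n`. -/
def levels (n : ℕ) : ℕ := Nat.log 2 (Nat.sqrt n) + 4

lemma six_sqrt_le_two_pow_levels (n : ℕ) : 6 * √(n : ℝ) ≤ 2 ^ levels n := by
  have h1 : Nat.sqrt n + 1 ≤ 2 ^ (Nat.log 2 (Nat.sqrt n) + 1) :=
    Nat.lt_pow_succ_log_self (by norm_num) _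
  have h2 : ((Nat.sqrt n : ℝ) + 1) ≤ 2 ^ (Nat.log 2 (Nat.sqrt n) + 1) := by exact_mod_cast h1
  have h3 : √(n : ℝ) ≤ Nat.sqrt n + 1 := Real.real_sqrt_lt_nat_sqrt_succ.le
  have h4 : (2 : ℝ) ^ levels n = 2 ^ (Nat.log 2 (Nat.sqrt n) + 1) * 8 := by
    rw [levels, show Nat.log 2 (Nat.sqrt n) + 4 = Nat.log 2 (Nat.sqrt n) + 1 + 3 by ring, pow_add]
    norm_num
  rw [h4]
  linarith [Real.sqrt_nonneg (n : ℝ)]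

lemma two_pow_levels_le (n : ℕ) (hn : 1 ≤ n) : (2 : ℝ) ^ levels n ≤ 16 * √(n : ℝ) := by
  have h1 : 2 ^ Nat.log 2 (Nat.sqrt n) ≤ Nat.sqrt n :=
    Nat.pow_log_le_self 2 (Nat.sqrt_pos.2 hn).ne'
  have h2 : (2 : ℝ) ^ Nat.log 2 (Nat.sqrt n) ≤ Nat.sqrt n := by exact_mod_cast h1
  have h3 : (Nat.sqrt n : ℝ) ≤ √(n : ℝ) := Real.nat_sqrt_le_real_sqrt
  rw [levels, pow_add]
  linarith

lemma levels_le (n : ℕ) (hn : 1 ≤ n) : (levels n : ℝ) ≤ 5 * logStar n := by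
  have h1 : 2 ^ Nat.log 2 (Nat.sqrt n) ≤ n :=
    (Nat.pow_log_le_self 2 (Nat.sqrt_pos.2 hn).ne').trans (Nat.sqrt_le_self n)
  have h2 : ((2 : ℝ) ^ (Nat.log 2 (Nat.sqrt n) : ℝ)) ≤ n := by
    rw [Real.rpow_natCast]
    exact_mod_cast h1
  have h3 : (Nat.log 2 (Nat.sqrt n) : ℝ) ≤ Real.logb 2 n :=
    (Real.le_logb_iff_rpow_le (by norm_num) (by exact_mod_cast hn)).2 h2
  have h4 : Real.logb 2 n ≤ logStar n := le_max_left _ _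
  rw [levels]
  push_cast
  linarith [one_le_logStar n]

lemma const_mul_four_pow_le_exp (Q : ℕ) (hQ : 4 ≤ Q) :
    256 * 4 ^ Q * (Q : ℝ) ≤ Real.exp (4 * Q) := by
  have h1 : (256 : ℝ) ≤ 4 ^ Q := by
    calc (256 : ℝ) = 4 ^ 4 := by norm_num
      _ ≤ 4 ^ Q := pow_le_pow_right₀ (by norm_num) hQ
  have h2 : (Q : ℝ) ≤ 2 ^ Q := by exact_mod_cast Nat.lt_two_pow_self.le
  have h3 : (32 : ℝ) ≤ Real.exp 4 := by
    have := exp_two_ge_five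
    rw [show (4 : ℝ) = 2 + 2 by norm_num, Real.exp_add]
    have h := Real.exp_one_gt_d9
    have h2 : Real.exp 2 = Real.exp 1 * Real.exp 1 := by rw [← Real.exp_add]; norm_num
    have h3 : (7 : ℝ) ≤ Real.exp 2 := by rw [h2]; nlinarith
    nlinarith
  calc 256 * 4 ^ Q * (Q : ℝ) ≤ 4 ^ Q * 4 ^ Q * 2 ^ Q := by gcongr
    _ = 32 ^ Q := by rw [← mul_pow, ← mul_pow]; norm_num
    _ ≤ Real.exp 4 ^ Q := pow_le_pow_left₀ (by norm_num) h3 Q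
    _ = _ := by rw [← Real.exp_nat_mul]; ring_nf

lemma log_five_mul_add_one_le (M : ℕ) (hM : 1 ≤ M) : Real.log (5 * M) + 1 ≤ 4 * logStar M := by
  have hM' : (1 : ℝ) ≤ M := by exact_mod_cast hM
  rw [Real.log_mul (by norm_num) (by positivity)]
  have h1 : Real.log 5 ≤ 2 := (Real.log_le_iff_le_exp (by norm_num)).2 exp_two_ge_five
  have h2 : Real.log M ≤ logStar M := by
    refine le_trans ?_ (le_max_left _ _)
    rw [Real.logb, le_div_iff₀ (Real.log_pos (by norm_num))]
    exact mul_le_of_le_one_right (Real.log_nonneg hM') (by linarith [Real.log_two_lt_d9])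
  linarith [one_le_logStar M]

/-- The sample sizes of the empirical averages at the dyadic levels. -/
def tupleSize (n j : ℕ) : ℕ := ⌈64 * (8 * (6 * √(n : ℝ)) / 2 ^ j) ^ 2 * (4 * levels n)⌉₊

lemma levels_ge (n : ℕ) : 4 ≤ levels n := Nat.le_add_left _ _

lemma tupleSize_pos (n j : ℕ) (hn : 1 ≤ n) : 0 < tupleSize n j := by
  have hn' : (0 : ℝ) < n := by exact_mod_cast hn
  have hQ : (0 : ℝ) < levels n := by exact_mod_cast (by have := levels_ge n; omega)
  exact Nat.ceil_pos.2 (by positivity)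

lemma exp_tupleSize_le (n j : ℕ) (hn : 1 ≤ n) (hj : j < levels n) :
    4 * Real.exp (-(tupleSize n j * (2 ^ j / (8 * (6 * √(n : ℝ)))) ^ 2 / 64)) ≤
      3 / (4 * 4 ^ j * levels n) / 16 := by
  have hn' : (0 : ℝ) < n := by exact_mod_cast hn
  have hQ : (0 : ℝ) < levels n := by exact_mod_cast (by have := levels_ge n; omega)
  have hs : 0 < √(n : ℝ) := Real.sqrt_pos.2 hn'
  have h1 : 64 * (8 * (6 * √(n : ℝ)) / 2 ^ j) ^ 2 * (4 * levels n) ≤ tupleSize n j :=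
    Nat.le_ceil _
  have h2 : 4 * (levels n : ℝ) ≤ tupleSize n j * (2 ^ j / (8 * (6 * √(n : ℝ)))) ^ 2 / 64 := by
    have h3 := mul_le_mul_of_nonneg_right h1
      (by positivity : 0 ≤ (2 ^ j / (8 * (6 * √(n : ℝ)))) ^ 2 / 64)
    refine le_trans (le_of_eq ?_) (h3.trans_eq (by ring))
    field_simp
  have h3 : Real.exp (-(tupleSize n j * (2 ^ j / (8 * (6 * √(n : ℝ)))) ^ 2 / 64)) ≤
      Real.exp (-(4 * levels n)) := Real.exp_le_exp.2 (by linarith)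
  have h4 := const_mul_four_pow_le_exp (levels n) (levels_ge n)
  have h5 : (4 : ℝ) ^ j ≤ 4 ^ levels n := pow_le_pow_right₀ (by norm_num) hj.le
  have h6 : Real.exp (-(4 * levels n)) ≤ 1 / (256 * 4 ^ j * levels n) := by
    rw [Real.exp_neg, ← one_div]
    refine one_div_le_one_div_of_le (by positivity) (le_trans ?_ h4)
    gcongr
  have h7 : (3 : ℝ) / (4 * 4 ^ j * levels n) / 16 = 12 * (1 / (256 * 4 ^ j * levels n)) := by
    field_simp
    norm_num
  have h8 : (0 : ℝ) < 1 / (256 * 4 ^ j * levels n) := by positivity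
  linarith

lemma tupleSize_le (n j : ℕ) (hn : 1 ≤ n) (hj : j < levels n) :
    4 ^ j * (tupleSize n j : ℝ) ≤ 592128 * n * levels n := by
  have hn' : (0 : ℝ) < n := by exact_mod_cast hn
  have hQ : (1 : ℝ) ≤ levels n := by exact_mod_cast (by have := levels_ge n; omega)
  have hs : √(n : ℝ) ^ 2 = n := Real.sq_sqrt hn'.le
  have h1 := (Nat.ceil_lt_add_one (by positivity :
    0 ≤ 64 * (8 * (6 * √(n : ℝ)) / 2 ^ j) ^ 2 * (4 * levels n))).le
  have e4 : (4 : ℝ) ^ j = (2 ^ j) ^ 2 := by rw [← pow_mul, mul_comm, pow_mul]; norm_num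
  have h2 : (4 : ℝ) ^ j ≤ 2304 * n := by
    have h3 : (2 : ℝ) ^ j ≤ 2 ^ levels n := pow_le_pow_right₀ (by norm_num) hj.le
    have h4 := h3.trans (two_pow_levels_le n hn)
    rw [e4]
    calc _ ≤ (16 * √(n : ℝ)) ^ 2 := pow_le_pow_left₀ (by positivity) h4 2
      _ = 256 * n := by rw [mul_pow, hs]; norm_num
      _ ≤ _ := by linarith
  have h5 := mul_le_mul_of_nonneg_left h1 (by positivity : (0 : ℝ) ≤ 4 ^ j)
  have h6 : (4 : ℝ) ^ j * (64 * (8 * (6 * √(n : ℝ)) / 2 ^ j) ^ 2 * (4 * levels n) + 1) =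
      589824 * n * levels n + 4 ^ j := by
    rw [div_pow, mul_pow, mul_pow, hs, e4]
    field_simp
    ring
  have h7 : (2304 : ℝ) * n ≤ 2304 * n * levels n := le_mul_of_one_le_right (by positivity) hQ
  calc _ ≤ _ := h5
    _ = _ := h6
    _ ≤ _ := by linarith

lemma tupleSize_mul_le (n j : ℕ) (hn : 1 ≤ n) (hj : j < levels n) (H m : ℝ) (hH : 0 ≤ H)
    (hm : 1500000000 * n * logStar n ^ 2 * H ≤ m) :
    7 * tupleSize n j * H ≤ m * (3 / 4 * (3 / (4 * 4 ^ j * levels n))) / 8 := by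
  have hn' : (0 : ℝ) < n := by exact_mod_cast hn
  have hQ : (0 : ℝ) < levels n := by exact_mod_cast (by have := levels_ge n; omega)
  have h1 := tupleSize_le n j hn hj
  have h2 := levels_le n hn
  have h3 : (levels n : ℝ) ^ 2 ≤ 25 * logStar n ^ 2 := by
    calc _ ≤ (5 * logStar n) ^ 2 := pow_le_pow_left₀ hQ.le h2 2
      _ = _ := by ring
  have h4 : m * (3 / 4 * (3 / (4 * 4 ^ j * levels n))) / 8 =
      9 / 128 * m / (4 ^ j * levels n) := by
    field_simp
    ring
  rw [h4, le_div_iff₀ (by positivity)]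
  have h5 : 4 ^ j * (tupleSize n j : ℝ) * levels n * H ≤ 592128 * n * levels n * levels n * H := by
    gcongr
  have h6 : (n : ℝ) * levels n ^ 2 * H ≤ n * (25 * logStar n ^ 2) * H := by gcongr
  have h7 : 0 ≤ (n : ℝ) * logStar n ^ 2 * H := by positivity
  nlinarith

/-- Sampling points that detect all trigonometric polynomials with small coefficient norm. -/
theorem exists_trig_points (d M n m : ℕ) (hd : 1 ≤ d) (hM : 1 ≤ M) (hn : 1 ≤ n)
    (hm : 6000000000 * (n : ℝ) * d * logStar n ^ 2 * logStar M ≤ m) :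
    ∃ x : Fin m → (Fin d → ℝ), (∀ i, x i ∈ cube d) ∧ ∀ α : vpBox d M → ℂ,
      ∑ k, ‖α k‖ ≤ 3 * √(n : ℝ) → ∑ k : vpBox d M, (vpW d M k * ‖α k‖) ^ 2 = 1 →
      ∃ i, 1 / 4 ≤ ‖∑ k : vpBox d M, α k * vpW d M k * expk d k (x i)‖ := by
  have hn' : (1 : ℝ) ≤ n := by exact_mod_cast hn
  have hd' : (1 : ℝ) ≤ d := by exact_mod_cast hd
  have hs : 1 ≤ √(n : ℝ) := Real.one_le_sqrt.2 hn'
  have hH0 := log_five_mul_nonneg hM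
  have hH1 := log_five_mul_add_one_le M hM
  have hl := one_le_logStar n
  have hlM := one_le_logStar M
  have hmpos : 0 < m := by
    have : (0 : ℝ) < m := lt_of_lt_of_le (by positivity) hm
    exact_mod_cast this
  have hmH : 1500000000 * n * logStar n ^ 2 * (d * (Real.log (5 * M) + 1)) ≤ m := by
    refine le_trans ?_ hm
    calc _ ≤ 1500000000 * n * logStar n ^ 2 * (d * (4 * logStar M)) := by gcongr
      _ = _ := by ring
  have hQ := levels_ge n
  obtain ⟨x, hx, hx2⟩ := exists_detecting_points (volume.restrict (cube d)) (cube d)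
    (by rw [Measure.restrict_apply (measurableSet_cube d).compl]; simp)
    (fun k : vpBox d M => expk d k) (fun k => (continuous_expk d k).measurable)
    (fun k x => (norm_expk d k x).le) (fun k => vpW d M k) (fun k => vpEll d M k)
    (fun k => vpW_nonneg hd hM k) (fun k => vpW_le_one hd hM k) (fun k => vpEll_nonneg d hM k)
    (by
      rw [Finset.sum_coe_sort (vpBox d M) fun k => Real.exp (-vpEll d M k)]
      exact sum_exp_neg_vpEll_le d hM)
    (d * (Real.log (5 * M) + 1)) (by nlinarith) (fun k => vpW_mul_vpEll_le hd hM k)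
    (6 * √(n : ℝ)) (by linarith) (levels n) (six_sqrt_le_two_pow_levels n)
    (by linarith [two_pow_levels_le n hn]) (tupleSize n) (fun j => tupleSize_pos n j hn)
    (fun j hj => exp_tupleSize_le n j hn hj) m hmpos
    (fun j hj => tupleSize_mul_le n j hn hj _ _ (by nlinarith) hmH)
  refine ⟨x, hx, fun α hα hα2 => hx2 α (by linarith) ?_⟩
  have h1 := integral_norm_sq_trig (d := d) (vpBox d M)
    fun k => if hk : k ∈ vpBox d M then α ⟨k, hk⟩ * vpW d M k else 0
  have h2 : ∀ x, ∑ k ∈ vpBox d M, (if hk : k ∈ vpBox d M then α ⟨k, hk⟩ * vpW d M k else 0) *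
      expk d k x = ∑ k : vpBox d M, α k * vpW d M k * expk d k x := by
    intro x
    rw [← Finset.sum_coe_sort]
    exact Finset.sum_congr rfl fun k _ => by simp
  simp only [h2] at h1
  rw [h1, ← hα2, ← Finset.sum_coe_sort]
  refine Finset.sum_congr rfl fun k _ => ?_
  simp [abs_of_nonneg (vpW_nonneg hd hM k), mul_comm]

/-- The square-root Lasso type functional has a minimizer. -/
lemma exists_lasso_minimizer {K : Type*} [Fintype K] {m : ℕ} (a : Fin m → K → ℂ) (w : ℝ)
    (hw : 0 ≤ w) (y : Fin m → ℂ) :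
    ∃ c : K → ℂ, ∀ c' : K → ℂ,
      ∑ k, ‖c k‖ + w * ‖fun i => ∑ k, c k * a i k - y i‖ ≤
        ∑ k, ‖c' k‖ + w * ‖fun i => ∑ k, c' k * a i k - y i‖ := by
  refine Continuous.exists_forall_le (f := fun c : K → ℂ =>
    ∑ k, ‖c k‖ + w * ‖fun i => ∑ k, c k * a i k - y i‖) (by fun_prop) ?_
  refine Filter.tendsto_atTop_mono (fun c => ?_) (tendsto_norm_cocompact_atTop (E := K → ℂ))
  have h1 : ‖c‖ ≤ ∑ k, ‖c k‖ := by
    refine (pi_norm_le_iff_of_nonneg (Finset.sum_nonneg fun k _ => norm_nonneg _)).2 fun k => ?_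
    exact Finset.single_le_sum (f := fun k => ‖c k‖) (fun k _ => norm_nonneg _) (Finset.mem_univ k)
  have h2 : 0 ≤ w * ‖fun i => ∑ k, c k * a i k - y i‖ := mul_nonneg hw (norm_nonneg _)
  linarith

/-- Stable recovery from noisy measurements of approximately sparse coefficients. -/
lemma exists_lasso_decoder {K : Type*} [Fintype K] [DecidableEq K] {m : ℕ} (a : Fin m → K → ℂ)
    (v : K → ℝ) (s : ℝ) (hs : 1 ≤ s)
    (hdet : ∀ (δ : K → ℂ) (B : ℝ), 0 ≤ B → ∑ k, ‖δ k‖ ≤ 3 * s * √(∑ k, (v k * ‖δ k‖) ^ 2) →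
      (∀ i, ‖∑ k, δ k * a i k‖ ≤ B) → √(∑ k, (v k * ‖δ k‖) ^ 2) ≤ 4 * B) :
    ∃ Dec : (Fin m → ℂ) → K → ℂ, ∀ (y : Fin m → ℂ) (α : K → ℂ) (S : Finset K) (τ r : ℝ),
      (S.card : ℝ) ≤ s ^ 2 → (∀ k ∈ S, v k = 1) → 0 ≤ τ → 0 ≤ r → ∑ k ∈ Sᶜ, ‖α k‖ ≤ τ →
      (∀ i, ‖∑ k, α k * a i k - y i‖ ≤ r) →
      √(∑ k, (v k * ‖Dec y k - α k‖) ^ 2) ≤ 2 * τ / s + 16 * r ∧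
        ∑ k, ‖Dec y k - α k‖ ≤ 6 * τ + 40 * s * r := by
  choose Dec hDec using exists_lasso_minimizer a (8 * s) (by linarith)
  refine ⟨Dec, fun y α S τ r hS hv hτ hr hατ hαr => ?_⟩
  set c := Dec y with hc
  set δ : K → ℂ := fun k => c k - α k with hδ
  set N := √(∑ k, (v k * ‖δ k‖) ^ 2) with hN
  set rc := ‖fun i => ∑ k, c k * a i k - y i‖ with hrc
  have hN0 : 0 ≤ N := Real.sqrt_nonneg _
  have hrc0 : 0 ≤ rc := norm_nonneg _
  have hs0 : 0 < s := by linarith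
  have hmin := hDec y α
  have hr' : ‖fun i => ∑ k, α k * a i k - y i‖ ≤ r := (pi_norm_le_iff_of_nonneg hr).2 hαr
  have hrc' : ∀ i, ‖∑ k, c k * a i k - y i‖ ≤ rc :=
    fun i => norm_le_pi_norm (fun i => ∑ k, c k * a i k - y i) i
  have hr2 := mul_le_mul_of_nonneg_left hr' (by linarith : 0 ≤ 8 * s)
  rw [← Finset.sum_add_sum_compl S, ← Finset.sum_add_sum_compl S fun k => ‖α k‖] at hmin
  have h1 : ∑ k ∈ S, ‖α k‖ ≤ ∑ k ∈ S, ‖c k‖ + ∑ k ∈ S, ‖δ k‖ := by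
    rw [← Finset.sum_add_distrib]
    refine Finset.sum_le_sum fun k _ => ?_
    have := norm_sub_le (c k) (δ k)
    simpa [hδ] using this
  have h2 : ∑ k ∈ Sᶜ, ‖δ k‖ ≤ ∑ k ∈ Sᶜ, ‖c k‖ + ∑ k ∈ Sᶜ, ‖α k‖ := by
    rw [← Finset.sum_add_distrib]
    exact Finset.sum_le_sum fun k _ => norm_sub_le (c k) (α k)
  have h3 : ∑ k ∈ S, ‖δ k‖ ≤ s * N := by
    have h4 : (∑ k ∈ S, ‖δ k‖) ^ 2 ≤ (s * N) ^ 2 := by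
      calc _ ≤ S.card * ∑ k ∈ S, ‖δ k‖ ^ 2 := sq_sum_le_card_mul_sum_sq
        _ ≤ s ^ 2 * ∑ k, (v k * ‖δ k‖) ^ 2 := by
          refine mul_le_mul hS ?_ (Finset.sum_nonneg fun k _ => sq_nonneg _) (sq_nonneg _)
          rw [show ∑ k ∈ S, ‖δ k‖ ^ 2 = ∑ k ∈ S, (v k * ‖δ k‖) ^ 2 from
            Finset.sum_congr rfl fun k hk => by rw [hv k hk, one_mul]]
          exact Finset.sum_le_sum_of_subset_of_nonneg (Finset.subset_univ _)
            fun k _ _ => sq_nonneg _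
        _ = _ := by
          rw [mul_pow, hN, Real.sq_sqrt (Finset.sum_nonneg fun k _ => sq_nonneg _)]
    exact (sq_le_sq₀ (Finset.sum_nonneg fun k _ => norm_nonneg _) (by positivity)).1 h4
  have h4 : ∑ k, ‖δ k‖ = ∑ k ∈ S, ‖δ k‖ + ∑ k ∈ Sᶜ, ‖δ k‖ := (Finset.sum_add_sum_compl S _).symm
  have h5 : ∑ k ∈ Sᶜ, ‖δ k‖ + 8 * s * rc ≤ ∑ k ∈ S, ‖δ k‖ + 2 * τ + 8 * s * r := by linarith
  have h6 : 0 ≤ ∑ k ∈ Sᶜ, ‖δ k‖ := Finset.sum_nonneg fun k _ => norm_nonneg _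
  have hsrc : 0 ≤ s * rc := mul_nonneg hs0.le hrc0
  have hsr : 0 ≤ s * r := mul_nonneg hs0.le hr
  have hmain : s * N ≤ 2 * τ + 16 * (s * r) := by
    by_cases hcase : ∑ k, ‖δ k‖ ≤ 3 * s * N
    · have h7 : N ≤ 4 * (rc + r) := by
        refine hdet δ (rc + r) (by linarith) hcase fun i => ?_
        have : ∑ k, δ k * a i k = (∑ k, c k * a i k - y i) - (∑ k, α k * a i k - y i) := by
          simp only [hδ, sub_mul, Finset.sum_sub_distrib]
          ring
        rw [this]
        exact (norm_sub_le _ _).trans (add_le_add (hrc' i) (hαr i))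
      have h8 := mul_le_mul_of_nonneg_left h7 hs0.le
      linarith
    · linarith
  constructor
  · rw [← sub_nonneg]
    have : 2 * τ / s + 16 * r - N = (2 * τ + 16 * (s * r) - s * N) / s := by field_simp
    rw [this]
    exact div_nonneg (by linarith) hs0.le
  · show ∑ k, ‖δ k‖ ≤ _
    linarith

/-- Interpolation between `L₂` and `L_∞` bounds. -/
lemma eLpNorm_le_of_sup_of_sq {X : Type*} [MeasurableSpace X] {μ : Measure X} {F : X → ℂ}
    {a s : ℝ≥0∞} (ha : a ≠ ∞) (hs : s ≠ ∞) (hsup : ∀ᵐ x ∂μ, ‖F x‖ₑ ≤ s * a)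
    (hsq : ∫⁻ x, ‖F x‖ₑ ^ (2 : ℝ) ∂μ ≤ a ^ (2 : ℝ)) {q : ℝ≥0∞} (hq : 2 ≤ q) :
    eLpNorm F q μ ≤ a * s ^ ((1 : ℝ) - 2 / q.toReal) := by
  rcases eq_or_ne q ∞ with rfl | hq'
  · have h0 : (1 : ℝ) - 2 / (∞ : ℝ≥0∞).toReal = 1 := by simp
    rw [h0, ENNReal.rpow_one, mul_comm, eLpNorm_exponent_top]
    exact essSup_le_of_ae_le _ hsup
  have hr : 2 ≤ q.toReal := by
    simpa using ENNReal.toReal_mono hq' hq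
  have hq0 : q ≠ 0 := (lt_of_lt_of_le (by norm_num) hq).ne'
  set r := q.toReal with hrdef
  rw [eLpNorm_eq_lintegral_rpow_enorm_toReal hq0 hq']
  have hr0 : 0 < r := by linarith
  have h1 : ∫⁻ x, ‖F x‖ₑ ^ r ∂μ ≤ s ^ (r - 2) * a ^ r := by
    calc _ ≤ ∫⁻ x, (s * a) ^ (r - 2) * ‖F x‖ₑ ^ (2 : ℝ) ∂μ := by
          refine lintegral_mono_ae ?_
          filter_upwards [hsup] with x hx
          calc ‖F x‖ₑ ^ r = ‖F x‖ₑ ^ (r - 2) * ‖F x‖ₑ ^ (2 : ℝ) := by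
                rw [← ENNReal.rpow_add_of_nonneg _ _ (by linarith) (by norm_num), sub_add_cancel]
            _ ≤ _ := by
                gcongr
      _ = (s * a) ^ (r - 2) * ∫⁻ x, ‖F x‖ₑ ^ (2 : ℝ) ∂μ :=
          lintegral_const_mul' _ _ (ENNReal.rpow_ne_top_of_nonneg (by linarith)
            (ENNReal.mul_ne_top hs ha))
      _ ≤ (s * a) ^ (r - 2) * a ^ (2 : ℝ) := by gcongr
      _ = _ := by
          rw [ENNReal.mul_rpow_of_nonneg _ _ (by linarith), mul_assoc,
            ← ENNReal.rpow_add_of_nonneg _ _ (by linarith) (by norm_num), sub_add_cancel]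
  calc _ ≤ (s ^ (r - 2) * a ^ r) ^ (1 / r) := by gcongr
    _ = _ := by
      rw [ENNReal.mul_rpow_of_nonneg _ _ (by positivity), ← ENNReal.rpow_mul, ← ENNReal.rpow_mul,
        mul_one_div_cancel hr0.ne', ENNReal.rpow_one, mul_comm]
      congr 2
      field_simp

/-- The de la Vallée Poussin weighted trigonometric polynomial with given coefficients. -/
def vpTrig (d M : ℕ) (α : vpBox d M → ℂ) (x : Fin d → ℝ) : ℂ :=
  ∑ k : vpBox d M, α k * (vpW d M k * expk d k x)

lemma vpTrig_eq_sum (d M : ℕ) (α : vpBox d M → ℂ) (x : Fin d → ℝ) :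
    vpTrig d M α x = ∑ k ∈ vpBox d M,
      (if hk : k ∈ vpBox d M then α ⟨k, hk⟩ * vpW d M k else 0) * expk d k x := by
  rw [vpTrig, ← Finset.sum_coe_sort (vpBox d M)]
  refine Finset.sum_congr rfl fun k _ => ?_
  simp [mul_assoc]

lemma continuous_vpTrig (d M : ℕ) (α : vpBox d M → ℂ) : Continuous (vpTrig d M α) := by
  simp only [funext fun x => vpTrig_eq_sum d M α x]
  exact continuous_trig _ _

lemma vpTrig_fCoeff (d M : ℕ) (f : (Fin d → ℝ) → ℂ) (x : Fin d → ℝ) :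
    vpTrig d M (fun k => fCoeff d f k) x = vpSum d M f x := by
  rw [vpTrig, vpSum, ← Finset.sum_coe_sort (vpBox d M)]
  refine Finset.sum_congr rfl fun k _ => ?_
  ring

lemma vpTrig_sub (d M : ℕ) (α β : vpBox d M → ℂ) (x : Fin d → ℝ) :
    vpTrig d M α x - vpTrig d M β x = vpTrig d M (fun k => α k - β k) x := by
  simp only [vpTrig, sub_mul, Finset.sum_sub_distrib]

lemma integral_norm_sq_vpTrig {d M : ℕ} (hd : 1 ≤ d) (hM : 1 ≤ M) (α : vpBox d M → ℂ) :
    ∫ x in cube d, ‖vpTrig d M α x‖ ^ 2 = ∑ k : vpBox d M, (vpW d M k * ‖α k‖) ^ 2 := by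
  simp only [vpTrig_eq_sum]
  rw [integral_norm_sq_trig, ← Finset.sum_coe_sort]
  refine Finset.sum_congr rfl fun k _ => ?_
  simp [abs_of_nonneg (vpW_nonneg hd hM k), mul_comm]

lemma norm_vpTrig_le {d M : ℕ} (hd : 1 ≤ d) (hM : 1 ≤ M) (α : vpBox d M → ℂ) (x : Fin d → ℝ) :
    ‖vpTrig d M α x‖ ≤ ∑ k, ‖α k‖ := by
  refine (norm_sum_le _ _).trans (Finset.sum_le_sum fun k _ => ?_)
  rw [norm_mul, norm_mul, norm_expk, mul_one, Complex.norm_real, Real.norm_eq_abs,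
    abs_of_nonneg (vpW_nonneg hd hM k)]
  exact mul_le_of_le_one_right (norm_nonneg _) (vpW_le_one hd hM k)

/-- Sampling points with a stable decoder for de la Vallée Poussin weighted polynomials. -/
lemma exists_points_decoder (d M n m : ℕ) (hd : 1 ≤ d) (hM : 1 ≤ M) (hn : 1 ≤ n)
    (hm : 6000000000 * (n : ℝ) * d * logStar n ^ 2 * logStar M ≤ m) :
    ∃ (x : Fin m → (Fin d → ℝ)) (Dec : (Fin m → ℂ) → vpBox d M → ℂ), (∀ i, x i ∈ cube d) ∧
      ∀ (y : Fin m → ℂ) (α : vpBox d M → ℂ) (S : Finset (vpBox d M)) (τ r : ℝ),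
        S.card ≤ n → (∀ k ∈ S, vpW d M k = 1) → 0 ≤ τ → 0 ≤ r → ∑ k ∈ Sᶜ, ‖α k‖ ≤ τ →
        (∀ i, ‖vpTrig d M α (x i) - y i‖ ≤ r) →
        √(∑ k : vpBox d M, (vpW d M k * ‖Dec y k - α k‖) ^ 2) ≤ 2 * τ / √(n : ℝ) + 16 * r ∧
          ∑ k, ‖Dec y k - α k‖ ≤ 6 * τ + 40 * √(n : ℝ) * r := by
  obtain ⟨x, hx, hx2⟩ := exists_trig_points d M n m hd hM hn hm
  have hs : 1 ≤ √(n : ℝ) := Real.one_le_sqrt.2 (by exact_mod_cast hn)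
  obtain ⟨Dec, hDec⟩ := exists_lasso_decoder (K := vpBox d M)
    (fun i k => (vpW d M k : ℂ) * expk d k (x i)) (fun k => vpW d M k) (√(n : ℝ)) hs (by
      intro δ B hB h1 h2
      set N := √(∑ k : vpBox d M, (vpW d M k * ‖δ k‖) ^ 2) with hN
      have hN0 : 0 ≤ N := Real.sqrt_nonneg _
      rcases hN0.eq_or_lt with h0 | hpos
      · rw [← h0]
        positivity
      have hNsq : N ^ 2 = ∑ k : vpBox d M, (vpW d M k * ‖δ k‖) ^ 2 :=
        Real.sq_sqrt (Finset.sum_nonneg fun k _ => sq_nonneg _)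
      have hnorm : ‖(N : ℂ)‖ = N := by simp [hN0]
      obtain ⟨i, hi⟩ := hx2 (fun k => δ k / N) (by
          simp only [norm_div, hnorm]
          rw [← Finset.sum_div, div_le_iff₀ hpos]
          exact h1) (by
          simp only [norm_div, hnorm, mul_div_assoc', div_pow]
          rw [← Finset.sum_div, ← hNsq, div_self (by positivity)])
      have h3 : ∑ k : vpBox d M, δ k / N * vpW d M k * expk d k (x i) =
          (∑ k : vpBox d M, δ k * (vpW d M k * expk d k (x i))) / N := by
        rw [Finset.sum_div]
        exact Finset.sum_congr rfl fun k _ => by ring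
      rw [h3, norm_div, hnorm, le_div_iff₀ hpos] at hi
      linarith [h2 i])
  refine ⟨x, Dec, hx, fun y α S τ r hS => hDec y α S τ r ?_⟩
  rw [Real.sq_sqrt (Nat.cast_nonneg n)]
  exact_mod_cast hS

/-- Fourier coefficients outside the relevant part of the support of an approximant are small. -/
lemma sum_norm_fCoeff_le {d M n : ℕ} {f g : (Fin d → ℝ) → ℂ} (hf : Continuous f)
    (hg : g ∈ boxPoly d M) {e σ : ℝ} (he0 : 0 ≤ e) (he : ∀ x ∈ cube d, ‖f x - g x‖ ≤ e)
    (Λ : Finset (Fin d → ℤ)) (c : (Fin d → ℤ) → ℂ) (hΛ : Λ.card ≤ n)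
    (hσ : ∀ T : Finset (Fin d → ℤ),
      ∑ k ∈ T, ‖fCoeff d (f - fun x => ∑ k ∈ Λ, c k * expk d k x) k‖ ≤ σ)
    (T : Finset (Fin d → ℤ)) (hT : ∀ k ∈ T, k ∈ Λ → ∃ i, (M : ℤ) < |k i|) :
    ∑ k ∈ T, ‖fCoeff d f k‖ ≤ σ + √(n : ℝ) * e := by
  classical
  rw [← Finset.sum_filter_add_sum_filter_not T (fun k => k ∉ Λ)]
  refine add_le_add ?_ ?_
  · refine le_trans (Finset.sum_le_sum fun k hk => ?_) (hσ (T.filter fun k => k ∉ Λ))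
    rw [fCoeff_sub hf (continuous_trig Λ c), fCoeff_trig, if_neg (Finset.mem_filter.1 hk).2,
      sub_zero]
  · set T' := T.filter fun k => ¬ k ∉ Λ with hT'
    have h1 : ∀ k ∈ T', fCoeff d f k = fCoeff d (f - g) k := by
      intro k hk
      obtain ⟨hk1, hk2⟩ := Finset.mem_filter.1 hk
      obtain ⟨i, hi⟩ := hT k hk1 (not_not.1 hk2)
      obtain ⟨Λ', b, hb, rfl⟩ := hg
      rw [fCoeff_sub hf (continuous_trig Λ' b), fCoeff_trig, if_neg, sub_zero]
      exact fun hk' => absurd (hb k hk' i) (not_le.2 hi)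
    rw [Finset.sum_congr rfl fun k hk => by rw [h1 k hk]]
    have hcard : (T'.card : ℝ) ≤ n := by
      have : T'.card ≤ Λ.card :=
        Finset.card_le_card fun k hk => not_not.1 (Finset.mem_filter.1 hk).2
      exact_mod_cast this.trans hΛ
    have hgc := continuous_of_mem_boxPoly hg
    have h2 : (∑ k ∈ T', ‖fCoeff d (f - g) k‖) ^ 2 ≤ (√(n : ℝ) * e) ^ 2 := by
      rw [mul_pow, Real.sq_sqrt (Nat.cast_nonneg n)]
      calc _ ≤ T'.card * ∑ k ∈ T', ‖fCoeff d (f - g) k‖ ^ 2 := sq_sum_le_card_mul_sum_sq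
        _ ≤ n * e ^ 2 := mul_le_mul hcard (sum_norm_fCoeff_sq_le (hf.sub hgc) he T')
          (Finset.sum_nonneg fun k _ => sq_nonneg _) (Nat.cast_nonneg n)
    exact (sq_le_sq₀ (Finset.sum_nonneg fun k _ => norm_nonneg _) (by positivity)).1 h2

/-- Real-valued pointwise and mean square bounds give an `L_q` bound on the cube. -/
lemma LqNorm_le_of_bounds {d : ℕ} {F : (Fin d → ℝ) → ℂ} (hF : Continuous F) {a s : ℝ}
    (ha : 0 ≤ a) (hs : 0 < s) (hsup : ∀ x ∈ cube d, ‖F x‖ ≤ s * a)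
    (hsq : ∫ x in cube d, ‖F x‖ ^ 2 ≤ a ^ 2) {q : ℝ≥0∞} (hq : 2 ≤ q) :
    LqNorm d q F ≤ ENNReal.ofReal (s ^ ((1 : ℝ) - 2 / q.toReal) * a) := by
  have h1 : LqNorm d q F ≤
      ENNReal.ofReal a * ENNReal.ofReal s ^ ((1 : ℝ) - 2 / q.toReal) := by
    refine eLpNorm_le_of_sup_of_sq ENNReal.ofReal_ne_top ENNReal.ofReal_ne_top ?_ ?_ hq
    · filter_upwards [ae_restrict_mem (measurableSet_cube d)] with x hx
      rw [← ofReal_norm, ← ENNReal.ofReal_mul hs.le]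
      exact ENNReal.ofReal_le_ofReal (hsup x hx)
    · have h2 : ∀ x, ‖F x‖ₑ ^ (2 : ℝ) = ENNReal.ofReal (‖F x‖ ^ 2) := by
        intro x
        rw [← ofReal_norm, ENNReal.rpow_ofNat, ENNReal.ofReal_pow (norm_nonneg _)]
      simp only [h2]
      rw [← ofReal_integral_eq_lintegral_ofReal
        (integrableOn_cube_of_continuous (by fun_prop : Continuous fun x => ‖F x‖ ^ 2))
        (Filter.Eventually.of_forall fun x => sq_nonneg _), ENNReal.rpow_ofNat,
        ← ENNReal.ofReal_pow ha]
      exact ENNReal.ofReal_le_ofReal hsq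
  rwa [ENNReal.ofReal_rpow_of_pos hs, mul_comm, ← ENNReal.ofReal_mul (by positivity)] at h1

/-- Finite partial sums of Fourier coefficients are bounded by the Wiener norm. -/
lemma sum_norm_fCoeff_le_wienerNorm {d : ℕ} {h : (Fin d → ℝ) → ℂ} (hfin : wienerNorm d 0 1 h ≠ ∞)
    (T : Finset (Fin d → ℤ)) : ∑ k ∈ T, ‖fCoeff d h k‖ ≤ (wienerNorm d 0 1 h).toReal := by
  have h1 : wienerNorm d 0 1 h = ∑' k, ‖fCoeff d h k‖ₑ := by
    simp [wienerNorm, enorm_eq_nnnorm]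
  rw [← ENNReal.ofReal_le_iff_le_toReal hfin, h1, ENNReal.ofReal_sum_of_nonneg
    fun k _ => norm_nonneg _]
  simp only [ofReal_norm]
  exact ENNReal.sum_le_tsum T

/-- Error bound for decoded samples relative to a fixed pair of approximants. -/
lemma LqNorm_sub_vpTrig_le {d M n m : ℕ} (hd : 1 ≤ d) (hM : 1 ≤ M) (hn : 1 ≤ n)
    {x : Fin m → (Fin d → ℝ)} (hx : ∀ i, x i ∈ cube d) {Dec : (Fin m → ℂ) → vpBox d M → ℂ}
    (hDec : ∀ (y : Fin m → ℂ) (α : vpBox d M → ℂ) (S : Finset (vpBox d M)) (τ r : ℝ),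
        S.card ≤ n → (∀ k ∈ S, vpW d M k = 1) → 0 ≤ τ → 0 ≤ r → ∑ k ∈ Sᶜ, ‖α k‖ ≤ τ →
        (∀ i, ‖vpTrig d M α (x i) - y i‖ ≤ r) →
        √(∑ k : vpBox d M, (vpW d M k * ‖Dec y k - α k‖) ^ 2) ≤ 2 * τ / √(n : ℝ) + 16 * r ∧
          ∑ k, ‖Dec y k - α k‖ ≤ 6 * τ + 40 * √(n : ℝ) * r)
    {f g p : (Fin d → ℝ) → ℂ} (hf : Continuous f) (hg : g ∈ boxPoly d M) (hp : p ∈ trigPoly d n)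
    {e σ : ℝ} (he0 : 0 ≤ e) (he : ∀ x ∈ cube d, ‖f x - g x‖ ≤ e)
    (hσ0 : 0 ≤ σ) (hσ : ∀ T : Finset (Fin d → ℤ), ∑ k ∈ T, ‖fCoeff d (f - p) k‖ ≤ σ)
    {q : ℝ≥0∞} (hq : 2 ≤ q) :
    LqNorm d q (f - vpTrig d M (Dec fun i => f (x i))) ≤
      ENNReal.ofReal (√(n : ℝ) ^ ((1 : ℝ) - 2 / q.toReal) * (375 * (σ / √(n : ℝ) + e))) := by
  classical
  obtain ⟨Λ, c, hΛ, rfl⟩ := hp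
  set s := √(n : ℝ) with hsdef
  have hs : 1 ≤ s := Real.one_le_sqrt.2 (by exact_mod_cast hn)
  have hs0 : 0 < s := by linarith
  set α : vpBox d M → ℂ := fun k => fCoeff d f k with hα
  set S : Finset (vpBox d M) :=
    Finset.univ.filter fun k => (k : Fin d → ℤ) ∈ Λ ∧ ∀ i, |(k : Fin d → ℤ) i| ≤ (M : ℤ) with hS
  have hvp := norm_sub_vpSum_le hd hM hf hg he0 he
  set β := Dec fun i => f (x i) with hβ
  obtain ⟨hN, hL1⟩ := hDec (fun i => f (x i)) α S (σ + s * e) (9 * e)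
    (by
      refine le_trans ?_ hΛ
      refine Finset.card_le_card_of_injOn (fun k => (k : Fin d → ℤ)) (fun k hk => ?_)
        (Subtype.val_injective.injOn)
      exact (Finset.mem_filter.1 hk).2.1)
    (fun k hk => Finset.prod_eq_one fun i _ =>
      vp1_eq_one (by nlinarith) ((Finset.mem_filter.1 hk).2.2 i))
    (by positivity) (by positivity)
    (by
      have := sum_norm_fCoeff_le hf hg he0 he Λ c hΛ hσ (Sᶜ.map (Function.Embedding.subtype _))
        (by
          intro k hk hkΛ
          obtain ⟨k', hk', rfl⟩ := Finset.mem_map.1 hk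
          by_contra! hcon
          exact Finset.mem_compl.1 hk' (Finset.mem_filter.2 ⟨Finset.mem_univ _, hkΛ, hcon⟩))
      simpa using this)
    (fun i => by
      rw [vpTrig_fCoeff, norm_sub_rev]
      exact hvp _ (hx i))
  set ρ := σ / s + e with hρ
  have hσs : 0 ≤ σ / s := by positivity
  have hsρ : s * ρ = σ + s * e := by
    rw [hρ, mul_add, mul_div_cancel₀ _ hs0.ne']
  have hsplit : ∀ z, f z - vpTrig d M β z =
      (f z - vpSum d M f z) - vpTrig d M (fun k => β k - α k) z := by
    intro z
    rw [← vpTrig_sub, ← vpTrig_fCoeff]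
    ring
  have hse : 0 ≤ s * e := by positivity
  have hes : e ≤ s * e := le_mul_of_one_le_left he0 hs
  have hF : Continuous (f - vpTrig d M β) := hf.sub (continuous_vpTrig d M β)
  refine LqNorm_le_of_bounds hF (by positivity) hs0 (fun z hz => ?_) ?_ hq
  · rw [Pi.sub_apply, hsplit]
    have h1 := norm_sub_le (f z - vpSum d M f z) (vpTrig d M (fun k => β k - α k) z)
    have h2 := norm_vpTrig_le hd hM (fun k => β k - α k) z
    have h3 := hvp z hz
    have h4 : s * (375 * ρ) = 375 * (σ + s * e) := by rw [← hsρ]; ring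
    linarith
  · have hN2 : ∑ k : vpBox d M, (vpW d M k * ‖β k - α k‖) ^ 2 ≤ (146 * ρ) ^ 2 := by
      have h0 : 0 ≤ ∑ k : vpBox d M, (vpW d M k * ‖β k - α k‖) ^ 2 :=
        Finset.sum_nonneg fun k _ => sq_nonneg _
      rw [← Real.sqrt_le_left (by positivity)]
      refine hN.trans ?_
      have : 2 * (σ + s * e) / s = 2 * ρ := by
        rw [← hsρ]
        field_simp
      rw [this]
      linarith
    have hc := continuous_vpTrig d M fun k => β k - α k
    calc ∫ z in cube d, ‖(f - vpTrig d M β) z‖ ^ 2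
        ≤ ∫ z in cube d, (2 * (9 * ρ) ^ 2 + 2 * ‖vpTrig d M (fun k => β k - α k) z‖ ^ 2) := by
          refine setIntegral_mono_on (integrableOn_cube_of_continuous (by fun_prop))
            (integrableOn_cube_of_continuous (by fun_prop)) (measurableSet_cube d) fun z hz => ?_
          rw [Pi.sub_apply, hsplit]
          have h1 := norm_sub_le (f z - vpSum d M f z) (vpTrig d M (fun k => β k - α k) z)
          have h3 : ‖f z - vpSum d M f z‖ ≤ 9 * ρ := (hvp z hz).trans (by linarith)
          have h5 : ‖f z - vpSum d M f z - vpTrig d M (fun k => β k - α k) z‖ ^ 2 ≤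
              (9 * ρ + ‖vpTrig d M (fun k => β k - α k) z‖) ^ 2 := by
            gcongr
            linarith
          refine h5.trans ?_
          nlinarith [sq_nonneg (9 * ρ - ‖vpTrig d M (fun k => β k - α k) z‖)]
      _ = 2 * (9 * ρ) ^ 2 + 2 * ∑ k : vpBox d M, (vpW d M k * ‖β k - α k‖) ^ 2 := by
          rw [integral_add (integrableOn_cube_of_continuous (by fun_prop))
            (integrableOn_cube_of_continuous (by fun_prop)),
            integral_const_mul (μ := volume.restrict (cube d)) 2 fun z =>
              ‖vpTrig d M (fun k => β k - α k) z‖ ^ 2,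
            integral_norm_sq_vpTrig hd hM]
          simp
      _ ≤ (375 * ρ) ^ 2 := by nlinarith [sq_nonneg ρ]

/-- instance-optimal sampling recovery via best m-term
approximation in the Wiener algebra. -/
theorem statement0 :
    ∃ C : ℝ, 0 < C ∧
      ∀ d M n : ℕ, 1 ≤ d → 1 ≤ M → 1 ≤ n →
      ∀ m : ℕ, ⌈C * (n : ℝ) * (d : ℝ) * (logStar n) ^ 2 * logStar M⌉₊ ≤ m →
      ∃ (x : Fin m → (Fin d → ℝ)) (R : (Fin m → ℂ) → ((Fin d → ℝ) → ℂ)),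
        (∀ i, x i ∈ cube d) ∧
        ∀ f : (Fin d → ℝ) → ℂ, Continuous f →
        ∀ q : ℝ≥0∞, 2 ≤ q →
          LqNorm d q (f - R fun i => f (x i)) ≤
            ENNReal.ofReal (C * (n : ℝ) ^ ((1:ℝ)/2 - 1/q.toReal)) *
              (ENNReal.ofReal ((n : ℝ) ^ (-(1:ℝ)/2)) * sigmaF d n (wienerNorm d 0 1) f
                + EBox d M f) := by
  refine ⟨6000000000, by norm_num, fun d M n hd hM hn m hm => ?_⟩
  obtain ⟨x, Dec, hx, hDec⟩ := exists_points_decoder d M n m hd hM hn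
    ((Nat.le_ceil _).trans (by exact_mod_cast hm))
  refine ⟨x, fun y => vpTrig d M (Dec y), hx, fun f hf q hq => ?_⟩
  have hn0 : (0 : ℝ) < n := by exact_mod_cast hn
  set A := ENNReal.ofReal (6000000000 * (n : ℝ) ^ ((1:ℝ)/2 - 1/q.toReal)) with hA
  set B := ENNReal.ofReal ((n : ℝ) ^ (-(1:ℝ)/2)) with hB
  have hA0 : A ≠ 0 := (ENNReal.ofReal_pos.2 (by positivity)).ne'
  have hB0 : B ≠ 0 := (ENNReal.ofReal_pos.2 (by positivity)).ne'
  have hAt : A ≠ ∞ := ENNReal.ofReal_ne_top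
  have hBt : B ≠ ∞ := ENNReal.ofReal_ne_top
  suffices h : ∀ p ∈ trigPoly d n, ∀ g ∈ boxPoly d M,
      LqNorm d q (f - vpTrig d M (Dec fun i => f (x i))) ≤
        A * (B * wienerNorm d 0 1 (f - p) + LqNorm d ∞ (f - g)) by
    simp only [sigmaF, EBox, ENNReal.mul_iInf_of_ne hB0 hBt, ENNReal.iInf_add, ENNReal.add_iInf,
      ENNReal.mul_iInf_of_ne hA0 hAt]
    exact le_iInf₂ fun g hg => le_iInf₂ fun p hp => h p hp g hg
  intro p hp g hg
  by_cases hW : wienerNorm d 0 1 (f - p) = ∞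
  · simp [hW, ENNReal.mul_top hB0, ENNReal.mul_top hA0]
  by_cases hL : LqNorm d ∞ (f - g) = ∞
  · simp [hL, ENNReal.mul_top hA0]
  have h1 := LqNorm_sub_vpTrig_le hd hM hn hx hDec hf hg hp
    (e := (LqNorm d ∞ (f - g)).toReal) ENNReal.toReal_nonneg
    (norm_le_of_LqNorm_top (hf.sub (continuous_of_mem_boxPoly hg)) hL) ENNReal.toReal_nonneg
    (sum_norm_fCoeff_le_wienerNorm hW) hq
  refine h1.trans ?_
  set σ := (wienerNorm d 0 1 (f - p)).toReal with hσ
  set e := (LqNorm d ∞ (f - g)).toReal with he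
  have hσ0 : 0 ≤ σ := ENNReal.toReal_nonneg
  have he0 : 0 ≤ e := ENNReal.toReal_nonneg
  rw [← ENNReal.ofReal_toReal hW, ← ENNReal.ofReal_toReal hL, ← hσ, ← he, hA, hB,
    ← ENNReal.ofReal_mul (by positivity), ← ENNReal.ofReal_add (by positivity) he0,
    ← ENNReal.ofReal_mul (by positivity)]
  refine ENNReal.ofReal_le_ofReal ?_
  have h2 : √(n : ℝ) ^ ((1 : ℝ) - 2 / q.toReal) = (n : ℝ) ^ ((1:ℝ)/2 - 1/q.toReal) := by
    rw [Real.sqrt_eq_rpow, ← Real.rpow_mul hn0.le]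
    congr 1
    ring
  have h3 : σ / √(n : ℝ) = (n : ℝ) ^ (-(1:ℝ)/2) * σ := by
    rw [Real.sqrt_eq_rpow, neg_div, Real.rpow_neg hn0.le]
    ring
  rw [h2, h3]
  have h4 : 0 ≤ (n : ℝ) ^ ((1:ℝ)/2 - 1/q.toReal) * ((n : ℝ) ^ (-(1:ℝ)/2) * σ + e) := by positivity
  linarith

end Paper
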